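/- Let $d \ge 2$, $s \in \left(\frac{d}{2d-1}, 1\right)$, and let $q$ satisfy $2 \le q < \frac{4s}{d-2s}$. There is a constant $C = C(d, s, q)$ such that for every radial Schwartz function $f$ on $\mathbb{R}^d$: $\|e^{-it(-\Delta)^s} f\|_{L^q_t L^\infty_x(\mathbb{R} \times \mathbb{R}^d)} \le C\, \|f\|_{H^s}$. -/

import Mathlib

open MeasureTheory Complex
open scoped ENNReal BigOperators RealInnerProductSpace

noncomputable section

abbrev Ed (d : ℕ) := EuclideanSpace ℝ (Fin d)

/-- Fourier transform with convention `(𝓕 f) ξ = ∫ e^{-i x·ξ} f x dx`. -/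
def FT {d : ℕ} (f : Ed d → ℂ) (ξ : Ed d) : ℂ :=
  ∫ x : Ed d, Complex.exp (-Complex.I * ((⟪x, ξ⟫ : ℝ) : ℂ)) * f x

/-- Inverse Fourier transform `(2π)^{-d} ∫ e^{i x·ξ} g ξ dξ`. -/
def FTinv {d : ℕ} (g : Ed d → ℂ) (x : Ed d) : ℂ :=
  (((2 * Real.pi) ^ (-(d : ℝ)) : ℝ) : ℂ) *
    ∫ ξ : Ed d, Complex.exp (Complex.I * ((⟪x, ξ⟫ : ℝ) : ℂ)) * g ξ

/-- Fractional Schrödinger propagator `e^{-it(-Δ)^s}`. -/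
def fprop {d : ℕ} (s t : ℝ) (f : Ed d → ℂ) : Ed d → ℂ :=
  FTinv (fun ξ => Complex.exp (-Complex.I * (t : ℂ) * ((‖ξ‖ ^ (2 * s) : ℝ) : ℂ)) * FT f ξ)

/-- Fractional derivative `D^σ = (-Δ)^{σ/2}`, the Fourier multiplier `|ξ|^σ`. -/
def fracD {d : ℕ} (σ : ℝ) (f : Ed d → ℂ) : Ed d → ℂ :=
  FTinv (fun ξ => ((‖ξ‖ ^ σ : ℝ) : ℂ) * FT f ξ)

/-- `(-Δ)^{β/2} e^{-it(-Δ)^s}`. -/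
def fracDProp {d : ℕ} (β s t : ℝ) (f : Ed d → ℂ) : Ed d → ℂ :=
  FTinv (fun ξ => ((‖ξ‖ ^ β : ℝ) : ℂ) *
    Complex.exp (-Complex.I * (t : ℂ) * ((‖ξ‖ ^ (2 * s) : ℝ) : ℂ)) * FT f ξ)

/-- Resolvent `(-Δ + λ)⁻¹`. -/
def resolv {d : ℕ} (lam : ℝ) (f : Ed d → ℂ) : Ed d → ℂ :=
  FTinv (fun ξ => FT f ξ / ((‖ξ‖ ^ 2 + lam : ℝ) : ℂ))

/-- Resolvent-regularization `u_λ = √(sin(πs)/π) (-Δ+λ)⁻¹ u`. -/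
def reg {d : ℕ} (s lam : ℝ) (f : Ed d → ℂ) : Ed d → ℂ :=
  fun x => ((Real.sqrt (Real.sin (Real.pi * s) / Real.pi) : ℝ) : ℂ) * resolv lam f x

/-- A function is radial if its value depends only on `|x|`. -/
def IsRadial {d : ℕ} (f : Ed d → ℂ) : Prop :=
  ∀ x y : Ed d, ‖x‖ = ‖y‖ → f x = f y

/-- Homogeneous Sobolev norm `‖f‖_{Ḣ^s} = (2π)^{-d/2} ‖ |ξ|^s 𝓕f ‖_{L²}`. -/
def HdotNorm {d : ℕ} (s : ℝ) (f : Ed d → ℂ) : ℝ :=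
  (2 * Real.pi) ^ (-(d : ℝ) / 2) *
    (eLpNorm (fun ξ : Ed d => ((‖ξ‖ ^ s : ℝ) : ℂ) * FT f ξ) 2 volume).toReal

/-- Inhomogeneous Sobolev norm `‖f‖_{H^s}² = ‖f‖_{L²}² + ‖f‖_{Ḣ^s}²`. -/
def HNorm {d : ℕ} (s : ℝ) (f : Ed d → ℂ) : ℝ :=
  Real.sqrt ((eLpNorm f 2 volume).toReal ^ 2 + HdotNorm s f ^ 2)

/-- Mixed space-time norm `L^q_t L^r_x (ℝ × ℝ^d)`. -/
def mixedNorm {d : ℕ} (q r : ℝ≥0∞) (F : ℝ → Ed d → ℂ) : ℝ≥0∞ :=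
  eLpNorm (fun t => (eLpNorm (F t) r volume).toReal) q volume

/-- Partial derivative `∂_j` of a complex-valued function. -/
def pd {d : ℕ} (j : Fin d) (f : Ed d → ℂ) (x : Ed d) : ℂ :=
  fderiv ℝ f x (EuclideanSpace.single j 1)

/-- Partial derivative `∂_j` of a real-valued function. -/
def pdR {d : ℕ} (j : Fin d) (f : Ed d → ℝ) (x : Ed d) : ℝ :=
  fderiv ℝ f x (EuclideanSpace.single j 1)

/-- Laplacian of a real-valued function. -/
def lapR {d : ℕ} (f : Ed d → ℝ) : Ed d → ℝ :=
  fun x => ∑ j : Fin d, pdR j (pdR j f) x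

/-- Rescaling `χ_R(x) = χ(x/R)`. -/
def chiR {d : ℕ} (χ : Ed d → ℝ) (R : ℝ) : Ed d → ℝ :=
  fun x => χ (R⁻¹ • x)


/-- Squared `H^{1/2}` norm `(2π)^{-d} ∫ (1+|ξ|²)^{1/2} |𝓕u(ξ)|² dξ`. -/
def H12sq {d : ℕ} (f : Ed d → ℂ) : ℝ :=
  (2 * Real.pi) ^ (-(d : ℝ)) * ∫ ξ : Ed d, (1 + ‖ξ‖ ^ 2) ^ ((1 : ℝ)/2) * ‖FT f ξ‖ ^ 2


/-- The integral of `cos (v cos θ)` over a full period; it equals `2π` times the Bessel function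
`J₀`. -/
def circleBessel (v : ℝ) : ℝ := ∫ θ in (0 : ℝ)..(2 * Real.pi), Real.cos (v * Real.cos θ)

/-- The derivative of `circleBessel`. -/
def circleBesselDeriv (v : ℝ) : ℝ :=
  ∫ θ in (0 : ℝ)..(2 * Real.pi), -Real.sin (v * Real.cos θ) * Real.cos θ

theorem hasDerivAt_circleBessel (v : ℝ) :
    HasDerivAt circleBessel (circleBesselDeriv v) v := by
  refine (intervalIntegral.hasDerivAt_integral_of_dominated_loc_of_deriv_le (μ := volume)
    (F := fun v θ => Real.cos (v * Real.cos θ))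
    (F' := fun v θ => -Real.sin (v * Real.cos θ) * Real.cos θ) (bound := fun _ => 1)
    (s := Set.univ) Filter.univ_mem ?_ ?_ ?_ ?_ ?_ ?_).2
  · exact Filter.Eventually.of_forall fun x => (by fun_prop : Continuous _).aestronglyMeasurable
  · exact (by fun_prop : Continuous _).intervalIntegrable _ _
  · exact (by fun_prop : Continuous _).aestronglyMeasurable
  · refine Filter.Eventually.of_forall fun θ _ x _ => ?_
    rw [norm_mul, norm_neg]
    exact mul_le_one₀ (Real.abs_sin_le_one _) (norm_nonneg _) (Real.abs_cos_le_one _)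
  · exact intervalIntegrable_const
  · refine Filter.Eventually.of_forall fun θ _ x _ => ?_
    simpa using ((hasDerivAt_id x).mul_const (Real.cos θ)).cos

theorem hasDerivAt_circleBesselDeriv (v : ℝ) :
    HasDerivAt circleBesselDeriv
      (∫ θ in (0 : ℝ)..(2 * Real.pi), -(Real.cos (v * Real.cos θ) * Real.cos θ ^ 2)) v := by
  refine (intervalIntegral.hasDerivAt_integral_of_dominated_loc_of_deriv_le (μ := volume)
    (F := fun v θ => -Real.sin (v * Real.cos θ) * Real.cos θ)
    (F' := fun v θ => -(Real.cos (v * Real.cos θ) * Real.cos θ ^ 2)) (bound := fun _ => 1)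
    (s := Set.univ) Filter.univ_mem ?_ ?_ ?_ ?_ ?_ ?_).2
  · exact Filter.Eventually.of_forall fun x => (by fun_prop : Continuous _).aestronglyMeasurable
  · exact (by fun_prop : Continuous _).intervalIntegrable _ _
  · exact (by fun_prop : Continuous _).aestronglyMeasurable
  · refine Filter.Eventually.of_forall fun θ _ x _ => ?_
    rw [norm_neg, norm_mul, norm_pow]
    exact mul_le_one₀ (Real.abs_cos_le_one _) (by positivity)
      (pow_le_one₀ (norm_nonneg _) (Real.abs_cos_le_one _))
  · exact intervalIntegrable_const
  · refine Filter.Eventually.of_forall fun θ _ x _ => ?_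
    refine (((hasDerivAt_id x).mul_const (Real.cos θ)).sin.neg.mul_const (Real.cos θ)).congr_deriv
      ?_
    simp only [id]
    ring

/-- Bessel's equation of order zero. -/
theorem circleBessel_ode (v : ℝ) :
    v * ((∫ θ in (0 : ℝ)..(2 * Real.pi), -(Real.cos (v * Real.cos θ) * Real.cos θ ^ 2))
      + circleBessel v) + circleBesselDeriv v = 0 := by
  have key : ∫ θ in (0 : ℝ)..(2 * Real.pi),
      (v * (-(Real.cos (v * Real.cos θ) * Real.cos θ ^ 2) + Real.cos (v * Real.cos θ))
        + -Real.sin (v * Real.cos θ) * Real.cos θ) = 0 := by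
    have h := intervalIntegral.integral_eq_sub_of_hasDerivAt (a := 0) (b := 2 * Real.pi)
      (f := fun θ => -(Real.sin θ * Real.sin (v * Real.cos θ)))
      (f' := fun θ => v * (-(Real.cos (v * Real.cos θ) * Real.cos θ ^ 2)
        + Real.cos (v * Real.cos θ)) + -Real.sin (v * Real.cos θ) * Real.cos θ)
      (fun θ _ => by
        refine ((Real.hasDerivAt_sin θ).mul
          (((Real.hasDerivAt_cos θ).const_mul v).sin)).neg.congr_deriv ?_
        linear_combination v * Real.cos (v * Real.cos θ) * Real.sin_sq_add_cos_sq θ)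
      ((by fun_prop : Continuous _).intervalIntegrable _ _)
    rw [h]
    simp
  rw [intervalIntegral.integral_add, intervalIntegral.integral_const_mul,
    intervalIntegral.integral_add] at key
  · exact key
  all_goals exact (by fun_prop : Continuous _).intervalIntegrable _ _

theorem hasDerivAt_circleBesselDeriv' {v : ℝ} (hv : v ≠ 0) :
    HasDerivAt circleBesselDeriv (-circleBessel v - circleBesselDeriv v / v) v := by
  refine (hasDerivAt_circleBesselDeriv v).congr_deriv ?_
  have := circleBessel_ode v
  generalize (∫ θ in (0 : ℝ)..(2 * Real.pi), -(Real.cos (v * Real.cos θ) * Real.cos θ ^ 2)) = S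
    at this ⊢
  field_simp
  linear_combination this

theorem continuous_circleBessel : Continuous circleBessel :=
  continuous_iff_continuousAt.2 fun v => (hasDerivAt_circleBessel v).continuousAt

/-- The Liouville normalisation `√v J(v)` of `circleBessel`. -/
def besselW (v : ℝ) : ℝ := √v * circleBessel v

/-- The derivative of `besselW`. -/
def besselWDeriv (v : ℝ) : ℝ := circleBessel v / (2 * √v) + √v * circleBesselDeriv v

theorem hasDerivAt_besselW {v : ℝ} (hv : 0 < v) : HasDerivAt besselW (besselWDeriv v) v := by
  refine ((Real.hasDerivAt_sqrt hv.ne').mul (hasDerivAt_circleBessel v)).congr_deriv ?_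
  rw [besselWDeriv]
  ring

theorem hasDerivAt_besselWDeriv {v : ℝ} (hv : 0 < v) :
    HasDerivAt besselWDeriv (-(1 + 1 / (4 * v ^ 2)) * besselW v) v := by
  have h1 := Real.hasDerivAt_sqrt hv.ne'
  have hs : √v ≠ 0 := (Real.sqrt_pos.2 hv).ne'
  refine (((hasDerivAt_circleBessel v).div (h1.const_mul 2) (by positivity)).add
    (h1.mul (hasDerivAt_circleBesselDeriv' hv.ne'))).congr_deriv ?_
  rw [besselW]
  have h2 : v = √v ^ 2 := (Real.sq_sqrt hv.le).symm
  generalize circleBessel v = x, circleBesselDeriv v = y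
  generalize √v = z at *
  subst h2
  field_simp
  ring

/-- The energy `w'² + (1 + 1/(4v²)) w²` is nonincreasing. -/
theorem besselW_bounded : ∃ C : ℝ, 0 < C ∧ ∀ v : ℝ, 1 / 2 ≤ v →
    |besselW v| ≤ C ∧ |besselWDeriv v| ≤ C := by
  set E : ℝ → ℝ := fun v => besselWDeriv v ^ 2 + (1 + 1 / (4 * v ^ 2)) * besselW v ^ 2 with hE
  have hd : ∀ v : ℝ, 0 < v → HasDerivAt E (-(1 / (2 * v ^ 3)) * besselW v ^ 2) v := by
    intro v hv
    have h3 : HasDerivAt (fun v : ℝ => 1 + 1 / (4 * v ^ 2)) (-(1 / (2 * v ^ 3))) v := by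
      refine ((((hasDerivAt_pow 2 v).const_mul 4).fun_inv (by positivity)).const_add
        1).congr_deriv ?_ |>.congr_of_eventuallyEq (Filter.Eventually.of_forall fun x => by simp)
      simp
      field_simp
      ring
    refine (((hasDerivAt_besselWDeriv hv).pow 2).add
      (h3.mul ((hasDerivAt_besselW hv).pow 2))).congr_deriv ?_
    simp
    ring
  have hanti : AntitoneOn E (Set.Ici (1 / 2)) := by
    refine antitoneOn_of_deriv_nonpos (convex_Ici _) ?_ ?_ ?_
    · intro v hv
      exact (hd v (lt_of_lt_of_le (by norm_num) hv)).continuousAt.continuousWithinAt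
    · intro v hv
      rw [interior_Ici] at hv
      exact (hd v (lt_trans (by norm_num) hv)).differentiableAt.differentiableWithinAt
    · intro v hv
      rw [interior_Ici] at hv
      have hv0 : 0 < v := lt_trans (by norm_num) hv
      rw [(hd v hv0).deriv, neg_mul, neg_nonpos]
      positivity
  refine ⟨√(E (1 / 2)) + 1, by positivity, fun v hv => ?_⟩
  have hle : E v ≤ E (1 / 2) := hanti (Set.mem_Ici.2 le_rfl) hv hv
  have hv0 : 0 < v := lt_of_lt_of_le (by norm_num) hv
  have hp : 0 ≤ 1 / (4 * v ^ 2) * besselW v ^ 2 := by positivity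
  simp only [hE] at hle
  constructor <;> refine le_trans (Real.abs_le_sqrt ?_) (le_add_of_nonneg_right zero_le_one)
  · simp only [hE]; nlinarith [sq_nonneg (besselWDeriv v)]
  · simp only [hE]; nlinarith [sq_nonneg (besselW v)]

/-- The slowly varying amplitude of `besselW` with respect to `e^{iv}`. -/
def besselAmp (v : ℝ) : ℂ :=
  ((besselW v : ℂ) - I * (besselWDeriv v : ℂ)) / 2 * Complex.exp (-(I * v))

theorem hasDerivAt_besselAmp {v : ℝ} (hv : 0 < v) :
    HasDerivAt besselAmp (I * besselW v / (8 * v ^ 2) * Complex.exp (-(I * v))) v := by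
  have h1 := (hasDerivAt_besselW hv).ofReal_comp
  have h2 := (hasDerivAt_besselWDeriv hv).ofReal_comp
  have h3 : HasDerivAt (fun v : ℝ => Complex.exp (-(I * v))) (Complex.exp (-(I * v)) * (-I)) v := by
    have := ((Complex.ofRealCLM.hasDerivAt (x := v)).const_mul I).neg.cexp
    simpa using this
  refine (((h1.sub (h2.const_mul I)).div_const 2).mul h3).congr_deriv ?_
  have hvc : (v : ℂ) ≠ 0 := by exact_mod_cast hv.ne'
  simp only [Pi.sub_apply]
  push_cast
  field_simp
  linear_combination (32 * v ^ 2 * (besselWDeriv v : ℂ)) * I_sq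

theorem besselW_eq (v : ℝ) : (besselW v : ℂ) =
    besselAmp v * Complex.exp (I * v)
      + (starRingEnd ℂ) (besselAmp v) * Complex.exp (-(I * v)) := by
  have h : Complex.exp (-(I * v)) * Complex.exp (I * v) = 1 := by
    rw [← Complex.exp_add]; simp
  have hc : (starRingEnd ℂ) (besselAmp v) =
      ((besselW v : ℂ) + I * (besselWDeriv v : ℂ)) / 2 * Complex.exp (I * v) := by
    simp [besselAmp, ← Complex.exp_conj, Complex.conj_ofNat]
  rw [hc, besselAmp]
  linear_combination (-(besselW v : ℂ)) * h

theorem besselAmp_bounded : ∃ C : ℝ, 0 < C ∧ ∀ v : ℝ, 1 / 2 ≤ v →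
    ‖besselAmp v‖ ≤ C ∧
      ‖I * besselW v / (8 * v ^ 2) * Complex.exp (-(I * v))‖ ≤ C / v ^ 2 := by
  obtain ⟨C, hC, h⟩ := besselW_bounded
  have he : ∀ v : ℝ, ‖Complex.exp (-(I * v))‖ = 1 := fun v => by
    rw [Complex.norm_exp]; simp
  refine ⟨C, hC, fun v hv => ⟨?_, ?_⟩⟩
  · rw [besselAmp, norm_mul, he, mul_one, norm_div]
    have h1 : ‖(besselW v : ℂ) - I * (besselWDeriv v : ℂ)‖ ≤ C + C := by
      refine (norm_sub_le _ _).trans ?_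
      simpa using add_le_add (h v hv).1 (h v hv).2
    have h2 : ‖(2 : ℂ)‖ = 2 := by simp
    rw [h2]
    linarith
  · have hv0 : 0 < v := lt_of_lt_of_le (by norm_num) hv
    rw [norm_mul, he, mul_one]
    simp only [norm_div, norm_mul, norm_I, one_mul, norm_real, norm_pow, Complex.norm_ofNat,
      Real.norm_eq_abs, sq_abs]
    have := (h v hv).1
    rw [div_le_div_iff₀ (by positivity) (by positivity)]
    nlinarith [sq_nonneg v, pow_pos hv0 2]

theorem norm_cexp_I_mul_ofReal (x : ℝ) : ‖Complex.exp (I * x)‖ = 1 := by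
  rw [Complex.norm_exp]; simp

/-- First derivative test: if `|φ'| ≥ μ` and `φ'' ≥ 0` on `[a, b]`, then
`|∫ e^{iφ}| ≤ 4 / μ`. -/
theorem norm_integral_cexp_le_of_deriv {a b μ : ℝ} (hab : a ≤ b) (hμ : 0 < μ)
    {φ φ' φ'' : ℝ → ℝ} (h1 : ∀ x ∈ Set.Icc a b, HasDerivAt φ (φ' x) x)
    (h2 : ∀ x ∈ Set.Icc a b, HasDerivAt φ' (φ'' x) x) (hc : ContinuousOn φ'' (Set.Icc a b))
    (h0 : ∀ x ∈ Set.Icc a b, 0 ≤ φ'' x) (hb : ∀ x ∈ Set.Icc a b, μ ≤ |φ' x|) :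
    ‖∫ x in a..b, Complex.exp (I * φ x)‖ ≤ 4 / μ := by
  have hu : Set.uIcc a b = Set.Icc a b := Set.uIcc_of_le hab
  have hne : ∀ x ∈ Set.Icc a b, φ' x ≠ 0 := fun x hx h => by
    have := hb x hx
    rw [h, abs_zero] at this
    exact absurd this (not_le.2 hμ)
  have hc' : ContinuousOn φ' (Set.Icc a b) := fun x hx => (h2 x hx).continuousAt.continuousWithinAt
  have hcφ : ContinuousOn φ (Set.Icc a b) := fun x hx => (h1 x hx).continuousAt.continuousWithinAt
  have hE : ContinuousOn (fun x => Complex.exp (I * φ x)) (Set.Icc a b) := by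
    exact Complex.continuous_exp.comp_continuousOn
      (continuousOn_const.mul (Complex.continuous_ofReal.comp_continuousOn hcφ))
  have hder : ∀ x ∈ Set.uIcc a b, HasDerivAt (fun x => -I * (((φ' x)⁻¹ : ℝ) : ℂ)
      * Complex.exp (I * φ x))
      (Complex.exp (I * φ x) + I * (((φ'' x) / (φ' x) ^ 2 : ℝ) : ℂ) * Complex.exp (I * φ x)) x := by
    intro x hx
    rw [hu] at hx
    have hi := ((h2 x hx).fun_inv (hne x hx)).ofReal_comp
    have he := ((h1 x hx).ofReal_comp.const_mul I).cexp
    refine ((hi.const_mul (-I)).mul he).congr_deriv ?_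
    have hnc : (φ' x : ℂ) ≠ 0 := by exact_mod_cast hne x hx
    push_cast
    field_simp
    linear_combination (-(φ' x : ℂ) ^ 2) * I_sq
  have hq : ContinuousOn (fun x => φ'' x / φ' x ^ 2) (Set.Icc a b) :=
    hc.div (hc'.pow 2) fun x hx => pow_ne_zero 2 (hne x hx)
  have hT : ContinuousOn
      (fun x => I * (((φ'' x) / (φ' x) ^ 2 : ℝ) : ℂ) * Complex.exp (I * φ x)) (Set.Icc a b) :=
    (continuousOn_const.mul (Complex.continuous_ofReal.comp_continuousOn hq)).mul hE
  have hiE : IntervalIntegrable (fun x => Complex.exp (I * φ x)) volume a b :=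
    (hE.mono hu.le).intervalIntegrable
  have hiT : IntervalIntegrable
      (fun x => I * (((φ'' x) / (φ' x) ^ 2 : ℝ) : ℂ) * Complex.exp (I * φ x)) volume a b :=
    (hT.mono hu.le).intervalIntegrable
  have hI := intervalIntegral.integral_eq_sub_of_hasDerivAt hder (hiE.add hiT)
  rw [intervalIntegral.integral_add hiE hiT] at hI
  have hq2 : ∫ x in a..b, φ'' x / φ' x ^ 2 = -(φ' b)⁻¹ - -(φ' a)⁻¹ := by
    refine intervalIntegral.integral_eq_sub_of_hasDerivAt (f := fun x => -(φ' x)⁻¹)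
      (fun x hx => ?_) (hq.mono hu.le).intervalIntegrable
    rw [hu] at hx
    refine ((h2 x hx).fun_inv (hne x hx)).neg.congr_deriv ?_
    ring
  have hinv : ∀ x ∈ Set.Icc a b, |(φ' x)⁻¹| ≤ 1 / μ := fun x hx => by
    rw [abs_inv, ← one_div]
    exact one_div_le_one_div_of_le hμ (hb x hx)
  have hTb : ‖∫ x in a..b, I * (((φ'' x) / (φ' x) ^ 2 : ℝ) : ℂ) * Complex.exp (I * φ x)‖
      ≤ 2 / μ := by
    refine (intervalIntegral.norm_integral_le_of_norm_le hab (g := fun x => φ'' x / φ' x ^ 2)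
      ?_ (hq.mono hu.le).intervalIntegrable).trans ?_
    · refine Filter.Eventually.of_forall fun x hx => ?_
      rw [norm_mul, norm_mul, norm_cexp_I_mul_ofReal, norm_I, one_mul, mul_one, norm_real,
        Real.norm_of_nonneg]
      exact div_nonneg (h0 x (Set.Ioc_subset_Icc_self hx)) (by positivity)
    · rw [hq2]
      have h3 := abs_le.1 (hinv a (Set.left_mem_Icc.2 hab))
      have h4 := abs_le.1 (hinv b (Set.right_mem_Icc.2 hab))
      have : (2 : ℝ) / μ = 1 / μ + 1 / μ := by ring
      linarith
  have hbd : ∀ x ∈ Set.Icc a b, ‖-I * (((φ' x)⁻¹ : ℝ) : ℂ) * Complex.exp (I * φ x)‖ ≤ 1 / μ := by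
    intro x hx
    rw [norm_mul, norm_mul, norm_cexp_I_mul_ofReal, norm_neg, norm_I, one_mul, mul_one, norm_real]
    exact hinv x hx
  have h5 := hbd a (Set.left_mem_Icc.2 hab)
  have h6 := hbd b (Set.right_mem_Icc.2 hab)
  rw [eq_sub_of_add_eq hI]
  refine (norm_sub_le _ _).trans ((add_le_add (norm_sub_le _ _) hTb).trans ?_)
  have : (4 : ℝ) / μ = 1 / μ + 1 / μ + 2 / μ := by ring
  linarith

/-- Second derivative test: if `φ'' ≥ lam > 0` on `[a, b]`, then `|∫ e^{iφ}| ≤ 10 / √lam`. -/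
theorem norm_integral_cexp_le_of_deriv2 {a b lam : ℝ} (hab : a ≤ b) (hlam : 0 < lam)
    {φ φ' φ'' : ℝ → ℝ} (h1 : ∀ x ∈ Set.Icc a b, HasDerivAt φ (φ' x) x)
    (h2 : ∀ x ∈ Set.Icc a b, HasDerivAt φ' (φ'' x) x) (hc : ContinuousOn φ'' (Set.Icc a b))
    (h0 : ∀ x ∈ Set.Icc a b, lam ≤ φ'' x) :
    ‖∫ x in a..b, Complex.exp (I * φ x)‖ ≤ 10 / √lam := by
  have hc' : ContinuousOn φ' (Set.Icc a b) := fun x hx => (h2 x hx).continuousAt.continuousWithinAt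
  have hcφ : ContinuousOn φ (Set.Icc a b) := fun x hx => (h1 x hx).continuousAt.continuousWithinAt
  have hE : ContinuousOn (fun x => Complex.exp (I * φ x)) (Set.Icc a b) := by
    exact Complex.continuous_exp.comp_continuousOn
      (continuousOn_const.mul (Complex.continuous_ofReal.comp_continuousOn hcφ))
  have hgrow : ∀ x ∈ Set.Icc a b, ∀ y ∈ Set.Icc a b, x ≤ y → lam * (y - x) ≤ φ' y - φ' x := by
    refine (convex_Icc a b).mul_sub_le_image_sub_of_le_deriv hc' ?_ ?_
    · intro x hx
      exact (h2 x (interior_subset hx)).differentiableAt.differentiableWithinAt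
    · intro x hx
      rw [(h2 x (interior_subset hx)).deriv]
      exact h0 x (interior_subset hx)
  obtain ⟨z, hz, hzr, hzl⟩ : ∃ z ∈ Set.Icc a b, (∀ x ∈ Set.Ioc z b, lam * (x - z) ≤ φ' x) ∧
      (∀ x ∈ Set.Ico a z, φ' x ≤ -(lam * (z - x))) := by
    have ha : a ∈ Set.Icc a b := Set.left_mem_Icc.2 hab
    have hb : b ∈ Set.Icc a b := Set.right_mem_Icc.2 hab
    rcases le_or_gt 0 (φ' a) with h | h
    · refine ⟨a, ha, fun x hx => ?_, fun x hx => absurd hx (by simp)⟩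
      linarith [hgrow a ha x (Set.Ioc_subset_Icc_self hx) hx.1.le]
    rcases le_or_gt (φ' b) 0 with h' | h'
    · refine ⟨b, hb, fun x hx => absurd hx (by simp), fun x hx => ?_⟩
      linarith [hgrow x (Set.Ico_subset_Icc_self hx) b hb hx.2.le]
    obtain ⟨z, hz, hz0⟩ := intermediate_value_Icc hab hc' ⟨h.le, h'.le⟩
    refine ⟨z, hz, fun x hx => ?_, fun x hx => ?_⟩
    · linarith [hgrow z hz x ⟨hz.1.trans hx.1.le, hx.2⟩ hx.1.le]
    · linarith [hgrow x ⟨hx.1, hx.2.le.trans hz.2⟩ z hz hx.2.le]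
  have hs : 0 < √lam := Real.sqrt_pos.2 hlam
  have hδ : lam * (1 / √lam) = √lam := by
    rw [mul_one_div, div_eq_iff hs.ne', Real.mul_self_sqrt hlam.le]
  have hδ0 : 0 < 1 / √lam := by positivity
  set l := max a (z - 1 / √lam) with hl
  set r := min b (z + 1 / √lam) with hr
  have hal : a ≤ l := le_max_left _ _
  have hlz : l ≤ z := max_le hz.1 (by linarith)
  have hzr' : z ≤ r := le_min hz.2 (by linarith)
  have hrb : r ≤ b := min_le_left _ _
  have hintg : ∀ x y : ℝ, a ≤ x → x ≤ y → y ≤ b →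
      IntervalIntegrable (fun x => Complex.exp (I * φ x)) volume x y := fun x y hx hxy hy => by
    refine (hE.mono ?_).intervalIntegrable
    rw [Set.uIcc_of_le hxy]
    exact Set.Icc_subset_Icc hx hy
  have hleft : ‖∫ x in a..l, Complex.exp (I * φ x)‖ ≤ 4 / √lam := by
    rcases le_or_gt (z - 1 / √lam) a with h | h
    · rw [hl, max_eq_left h, intervalIntegral.integral_same, norm_zero]
      positivity
    · have hl' : l = z - 1 / √lam := max_eq_right h.le
      have hsub : Set.Icc a l ⊆ Set.Icc a b := Set.Icc_subset_Icc le_rfl (by linarith)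
      refine norm_integral_cexp_le_of_deriv hal hs (fun x hx => h1 x (hsub hx))
        (fun x hx => h2 x (hsub hx)) (hc.mono hsub) (fun x hx => hlam.le.trans (h0 x (hsub hx)))
        fun x hx => ?_
      have hxl : x ≤ z - 1 / √lam := hl' ▸ hx.2
      have h3 := hzl x ⟨hx.1, by linarith⟩
      have h4 : lam * (1 / √lam) ≤ lam * (z - x) := by gcongr; linarith
      rw [hδ] at h4
      rw [le_abs]
      right
      linarith
  have hright : ‖∫ x in r..b, Complex.exp (I * φ x)‖ ≤ 4 / √lam := by
    rcases le_or_gt b (z + 1 / √lam) with h | h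
    · rw [hr, min_eq_left h, intervalIntegral.integral_same, norm_zero]
      positivity
    · have hr' : r = z + 1 / √lam := min_eq_right h.le
      have hsub : Set.Icc r b ⊆ Set.Icc a b := Set.Icc_subset_Icc (by linarith) le_rfl
      refine norm_integral_cexp_le_of_deriv hrb hs (fun x hx => h1 x (hsub hx))
        (fun x hx => h2 x (hsub hx)) (hc.mono hsub) (fun x hx => hlam.le.trans (h0 x (hsub hx)))
        fun x hx => ?_
      have hxr : z + 1 / √lam ≤ x := hr' ▸ hx.1
      have h3 := hzr x ⟨by linarith, hx.2⟩
      have h4 : lam * (1 / √lam) ≤ lam * (x - z) := by gcongr; linarith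
      rw [hδ] at h4
      rw [le_abs]
      left
      linarith
  have hmid : ‖∫ x in l..r, Complex.exp (I * φ x)‖ ≤ 2 / √lam := by
    refine (intervalIntegral.norm_integral_le_of_norm_le_const
      (fun x _ => (norm_cexp_I_mul_ofReal (φ x)).le)).trans ?_
    rw [one_mul, abs_of_nonneg (by linarith)]
    have h3 : z - 1 / √lam ≤ l := le_max_right _ _
    have h4 : r ≤ z + 1 / √lam := min_le_right _ _
    have : (2 : ℝ) / √lam = 1 / √lam + 1 / √lam := by ring
    linarith
  rw [← intervalIntegral.integral_add_adjacent_intervals (hintg a r le_rfl (by linarith) hrb)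
    (hintg r b (by linarith) hrb le_rfl),
    ← intervalIntegral.integral_add_adjacent_intervals (hintg a l le_rfl hal (by linarith))
    (hintg l r hal (by linarith) hrb)]
  refine (norm_add₃_le).trans ?_
  have : (10 : ℝ) / √lam = 4 / √lam + 2 / √lam + 4 / √lam := by ring
  linarith

/-- The second derivative test with an amplitude. -/
theorem norm_integral_cexp_mul_le_of_deriv2 {a b lam M M' : ℝ} (hab : a ≤ b) (hlam : 0 < lam)
    {φ φ' φ'' : ℝ → ℝ} (h1 : ∀ x ∈ Set.Icc a b, HasDerivAt φ (φ' x) x)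
    (h2 : ∀ x ∈ Set.Icc a b, HasDerivAt φ' (φ'' x) x) (hc : ContinuousOn φ'' (Set.Icc a b))
    (h0 : ∀ x ∈ Set.Icc a b, lam ≤ φ'' x) {A A' : ℝ → ℂ}
    (hA : ∀ x ∈ Set.Icc a b, HasDerivAt A (A' x) x) (hA' : ContinuousOn A' (Set.Icc a b))
    (hM : ‖A b‖ ≤ M) (hM' : ∀ x ∈ Set.Icc a b, ‖A' x‖ ≤ M') :
    ‖∫ x in a..b, Complex.exp (I * φ x) * A x‖ ≤ 10 / √lam * (M + M' * (b - a)) := by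
  have hu : Set.uIcc a b = Set.Icc a b := Set.uIcc_of_le hab
  have hcφ : ContinuousOn φ (Set.Icc a b) := fun x hx => (h1 x hx).continuousAt.continuousWithinAt
  have hE : ContinuousOn (fun x => Complex.exp (I * φ x)) (Set.Icc a b) := by
    exact Complex.continuous_exp.comp_continuousOn
      (continuousOn_const.mul (Complex.continuous_ofReal.comp_continuousOn hcφ))
  set P : ℝ → ℂ := fun y => ∫ x in a..y, Complex.exp (I * φ x) with hP
  have hPb : ∀ y ∈ Set.Icc a b, ‖P y‖ ≤ 10 / √lam := fun y hy => by
    have hsub : Set.Icc a y ⊆ Set.Icc a b := Set.Icc_subset_Icc le_rfl hy.2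
    exact norm_integral_cexp_le_of_deriv2 hy.1 hlam (fun x hx => h1 x (hsub hx))
      (fun x hx => h2 x (hsub hx)) (hc.mono hsub) (fun x hx => h0 x (hsub hx))
  have hiE : IntervalIntegrable (fun x => Complex.exp (I * φ x)) volume a b :=
    (hE.mono hu.le).intervalIntegrable
  have hPc : ContinuousOn P (Set.uIcc a b) :=
    intervalIntegral.continuousOn_primitive_interval' hiE (by simp)
  have hcA : ContinuousOn A (Set.uIcc a b) := fun x hx =>
    (hA x (hu ▸ hx)).continuousAt.continuousWithinAt
  have hPd : ∀ x ∈ Set.Ioo (min a b) (max a b), HasDerivAt P (Complex.exp (I * φ x)) x := by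
    rw [min_eq_left hab, max_eq_right hab]
    intro x hx
    have hn : Set.Icc a b ∈ nhds x := Icc_mem_nhds hx.1 hx.2
    refine intervalIntegral.integral_hasDerivAt_right
      (hiE.mono_set (by rw [hu, Set.uIcc_of_le hx.1.le]; exact Set.Icc_subset_Icc le_rfl hx.2.le))
      ?_ (hE.continuousAt hn)
    exact (hE.mono Set.Ioo_subset_Icc_self).stronglyMeasurableAtFilter isOpen_Ioo x hx
  have hparts := intervalIntegral.integral_deriv_mul_eq_sub_of_hasDerivAt hPc hcA hPd
    (fun x hx => by
      rw [min_eq_left hab, max_eq_right hab] at hx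
      exact hA x (Set.Ioo_subset_Icc_self hx))
    hiE (hA'.mono hu.le).intervalIntegrable
  have hi1 : IntervalIntegrable (fun x => Complex.exp (I * φ x) * A x) volume a b :=
    ((hE.mono hu.le).mul hcA).intervalIntegrable
  have hi2 : IntervalIntegrable (fun x => P x * A' x) volume a b :=
    (hPc.mul (hA'.mono hu.le)).intervalIntegrable
  rw [intervalIntegral.integral_add hi1 hi2] at hparts
  have hPa : P a = 0 := by simp [hP]
  rw [hPa, zero_mul, sub_zero] at hparts
  rw [eq_sub_of_add_eq hparts]
  have h0' : 0 ≤ 10 / √lam := by positivity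
  refine (norm_sub_le _ _).trans ?_
  rw [mul_add]
  refine add_le_add ?_ ?_
  · rw [norm_mul]
    exact mul_le_mul (hPb b (Set.right_mem_Icc.2 hab)) hM (norm_nonneg _) h0'
  · refine (intervalIntegral.norm_integral_le_of_norm_le_const (C := 10 / √lam * M')
      fun x hx => ?_).trans ?_
    · rw [Set.uIoc_of_le hab] at hx
      have hx' := Set.Ioc_subset_Icc_self hx
      rw [norm_mul]
      exact mul_le_mul (hPb x hx') (hM' x hx') (norm_nonneg _) h0'
    · rw [abs_of_nonneg (sub_nonneg.2 hab), mul_assoc]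

/-- The dispersive bound for `∫ e^{i(cρ - τρ^a)} A(ρ) dρ` over `[1/2, 4]`. -/
theorem norm_integral_dispersive_le {a : ℝ} (ha : 1 < a) (ha2 : a < 2) :
    ∃ C : ℝ, 0 < C ∧ ∀ (c τ M : ℝ) (A A' : ℝ → ℂ), τ ≠ 0 → 0 ≤ M →
      (∀ x ∈ Set.Icc (1 / 2 : ℝ) 4, HasDerivAt A (A' x) x) →
      ContinuousOn A' (Set.Icc (1 / 2 : ℝ) 4) → (∀ x ∈ Set.Icc (1 / 2 : ℝ) 4, ‖A x‖ ≤ M) →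
      (∀ x ∈ Set.Icc (1 / 2 : ℝ) 4, ‖A' x‖ ≤ M) →
      ‖∫ x in (1 / 2 : ℝ)..4, Complex.exp (I * (c * x - τ * x ^ a : ℝ)) * A x‖
        ≤ C * M / √|τ| := by
  set κ : ℝ := a * (a - 1) * (4 : ℝ) ^ (a - 2) with hκ
  have hκ0 : 0 < κ := mul_pos (mul_pos (by linarith) (by linarith)) (by positivity)
  have h4 : ∀ x ∈ Set.Icc (1 / 2 : ℝ) 4, 0 < x := fun x hx => lt_of_lt_of_le (by norm_num) hx.1
  have neg_case : ∀ (c τ M : ℝ) (A A' : ℝ → ℂ), τ < 0 → 0 ≤ M →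
      (∀ x ∈ Set.Icc (1 / 2 : ℝ) 4, HasDerivAt A (A' x) x) →
      ContinuousOn A' (Set.Icc (1 / 2 : ℝ) 4) → (∀ x ∈ Set.Icc (1 / 2 : ℝ) 4, ‖A x‖ ≤ M) →
      (∀ x ∈ Set.Icc (1 / 2 : ℝ) 4, ‖A' x‖ ≤ M) →
      ‖∫ x in (1 / 2 : ℝ)..4, Complex.exp (I * (c * x - τ * x ^ a : ℝ)) * A x‖
        ≤ 45 / √κ * M / √|τ| := by
    intro c τ M A A' hτ hM hA hA' hb hb'
    have hlam : 0 < κ * |τ| := mul_pos hκ0 (abs_pos.2 hτ.ne)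
    have hmain := norm_integral_cexp_mul_le_of_deriv2 (a := 1 / 2) (b := 4) (lam := κ * |τ|)
      (M := M) (M' := M) (φ := fun x => c * x - τ * x ^ a)
      (φ' := fun x => c - τ * (a * x ^ (a - 1)))
      (φ'' := fun x => |τ| * (a * ((a - 1) * x ^ (a - 2)))) (by norm_num) hlam
      (fun x hx => by
        have := (Real.hasDerivAt_rpow_const (p := a) (Or.inl (h4 x hx).ne')).const_mul τ
        refine (((hasDerivAt_id x).const_mul c).sub this).congr_deriv ?_
        rw [mul_one])
      (fun x hx => by
        have := ((Real.hasDerivAt_rpow_const (p := a - 1)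
          (Or.inl (h4 x hx).ne')).const_mul a).const_mul τ
        refine (this.const_sub c).congr_deriv ?_
        rw [abs_of_neg hτ, show a - 1 - 1 = a - 2 by ring]
        ring)
      (by
        refine continuousOn_const.mul (continuousOn_const.mul (continuousOn_const.mul ?_))
        exact continuousOn_id.rpow_const fun x hx => Or.inl (h4 x hx).ne')
      (fun x hx => by
        have h5 : (4 : ℝ) ^ (a - 2) ≤ x ^ (a - 2) :=
          Real.rpow_le_rpow_of_nonpos (h4 x hx) hx.2 (by linarith)
        have h6 : a * (a - 1) * (4 : ℝ) ^ (a - 2) ≤ a * (a - 1) * x ^ (a - 2) :=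
          mul_le_mul_of_nonneg_left h5 (mul_nonneg (by linarith) (by linarith))
        have := mul_le_mul_of_nonneg_left h6 (abs_nonneg τ)
        linarith)
      hA hA' (hb 4 (by norm_num)) hb'
    refine hmain.trans (le_of_eq ?_)
    rw [Real.sqrt_mul hκ0.le]
    have : √|τ| ≠ 0 := (Real.sqrt_pos.2 (abs_pos.2 hτ.ne)).ne'
    have : √κ ≠ 0 := (Real.sqrt_pos.2 hκ0).ne'
    field_simp
    ring
  refine ⟨45 / √κ, by positivity, fun c τ M A A' hτ hM hA hA' hb hb' => ?_⟩
  rcases lt_or_gt_of_ne hτ with h | h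
  · exact neg_case c τ M A A' h hM hA hA' hb hb'
  · have hconj := neg_case (-c) (-τ) M (fun x => (starRingEnd ℂ) (A x))
      (fun x => (starRingEnd ℂ) (A' x)) (by linarith) hM
      (fun x hx => by simpa using (hA x hx).star) (Complex.continuous_conj.comp_continuousOn hA')
      (fun x hx => by simpa using hb x hx) (fun x hx => by simpa using hb' x hx)
    rw [abs_neg] at hconj
    refine le_trans (le_of_eq ?_) hconj
    rw [← RCLike.norm_conj, intervalIntegral.integral_of_le (by norm_num),
      intervalIntegral.integral_of_le (by norm_num), ← integral_conj]
    congr 2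
    funext x
    simp only [map_mul, ← Complex.exp_conj, conj_I, conj_ofReal]
    congr 2
    push_cast
    ring

theorem contDiff_mul_of_tsupport_subset {χ g : ℝ → ℂ} (hχ : ContDiff ℝ (⊤ : ℕ∞) χ)
    (hs : tsupport χ ⊆ Set.Ioo (1 / 2 : ℝ) 4) (hg : ∀ x, 0 < x → ContDiffAt ℝ (⊤ : ℕ∞) g x) :
    ContDiff ℝ (⊤ : ℕ∞) fun x => χ x * g x := by
  rw [contDiff_iff_contDiffAt]
  intro x
  by_cases hx : x ∈ tsupport fun x => χ x * g x
  · exact hχ.contDiffAt.mul (hg x (lt_trans (by norm_num) (hs (tsupport_mul_subset_left hx)).1))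
  · exact (contDiffAt_const (c := (0 : ℂ))).congr_of_eventuallyEq
      (notMem_tsupport_iff_eventuallyEq.1 hx)

/-- Repeated integration by parts for `∫ e^{i(cρ - τρ^a)} χ(ρ) dρ`. -/
theorem norm_integral_nonstationary_le {a : ℝ} (ha : 1 < a) (n : ℕ) :
    ∀ χ : ℝ → ℂ, ContDiff ℝ (⊤ : ℕ∞) χ → tsupport χ ⊆ Set.Ioo (1 / 2 : ℝ) 4 →
      ∃ C : ℝ, 0 ≤ C ∧ ∀ c τ : ℝ, τ ≠ 0 →
        ‖∫ x in (1 / 2 : ℝ)..4, Complex.exp (I * (c * x - τ * x ^ a : ℝ)) * χ x‖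
          ≤ C * ((1 + |c|) / |τ|) ^ n := by
  have hcE : ∀ c τ : ℝ, Continuous fun x : ℝ => Complex.exp (I * (c * x - τ * x ^ a : ℝ)) := by
    intro c τ
    have : Continuous fun x : ℝ => x ^ a := continuous_id.rpow_const fun x => Or.inr (by linarith)
    fun_prop
  induction n with
  | zero =>
    intro χ hχ _
    obtain ⟨C, hC⟩ := isCompact_Icc.exists_bound_of_continuousOn (s := Set.Icc (1 / 2 : ℝ) 4)
      hχ.continuous.continuousOn
    have hC0 : 0 ≤ C := (norm_nonneg _).trans (hC 1 (by norm_num))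
    refine ⟨C * |4 - 1 / 2|, by positivity, fun c τ _ => ?_⟩
    rw [pow_zero, mul_one]
    refine intervalIntegral.norm_integral_le_of_norm_le_const fun x hx => ?_
    rw [Set.uIoc_of_le (by norm_num)] at hx
    rw [norm_mul, norm_cexp_I_mul_ofReal, one_mul]
    exact hC x (Set.Ioc_subset_Icc_self hx)
  | succ n ih =>
    intro χ hχ hs
    set η : ℝ → ℂ := fun x => χ x * ((x ^ (1 - a) / a : ℝ) : ℂ) with hη
    have hsη : tsupport η ⊆ Set.Ioo (1 / 2 : ℝ) 4 := tsupport_mul_subset_left.trans hs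
    have hdη : ContDiff ℝ (⊤ : ℕ∞) η := contDiff_mul_of_tsupport_subset hχ hs fun x hx =>
      Complex.ofRealCLM.contDiff.contDiffAt.comp x
        ((contDiffAt_id.rpow_const_of_ne hx.ne').div_const a)
    have hdη' : ContDiff ℝ (⊤ : ℕ∞) (deriv η) := hdη.deriv'
    obtain ⟨C₁, hC₁, h₁⟩ := ih η hdη hsη
    obtain ⟨C₂, hC₂, h₂⟩ := ih (deriv η) hdη' ((tsupport_deriv_subset (𝕜 := ℝ)).trans hsη)
    refine ⟨C₁ + C₂, by positivity, fun c τ hτ => ?_⟩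
    have hzero : ∀ x, x ∉ Set.Ioo (1 / 2 : ℝ) 4 → η x = 0 := fun x hx =>
      image_eq_zero_of_notMem_tsupport fun h => hx (hsη h)
    have hder : ∀ x ∈ Set.uIcc (1 / 2 : ℝ) 4, HasDerivAt
        (fun x : ℝ => Complex.exp (I * (c * x - τ * x ^ a : ℝ)) * η x)
        (I * c * (Complex.exp (I * (c * x - τ * x ^ a : ℝ)) * η x)
          + Complex.exp (I * (c * x - τ * x ^ a : ℝ)) * deriv η x
          - I * τ * (Complex.exp (I * (c * x - τ * x ^ a : ℝ)) * χ x)) x := by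
      intro x hx
      rw [Set.uIcc_of_le (by norm_num)] at hx
      have hx0 : 0 < x := lt_of_lt_of_le (by norm_num) hx.1
      have e1 : HasDerivAt (fun x : ℝ => c * x - τ * x ^ a) (c * 1 - τ * (a * x ^ (a - 1))) x :=
        ((hasDerivAt_id x).const_mul c).sub
          ((Real.hasDerivAt_rpow_const (p := a) (Or.inl hx0.ne')).const_mul τ)
      refine ((e1.ofReal_comp.const_mul I).cexp.mul
        (hdη.differentiable (by simp) x).hasDerivAt).congr_deriv ?_
      have hinv : ((x ^ (a - 1) : ℝ) : ℂ) * ((x ^ (1 - a) : ℝ) : ℂ) = 1 := by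
        rw [← ofReal_mul, ← Real.rpow_add hx0]
        simp
      have hac : (a : ℂ) ≠ 0 := by exact_mod_cast (by linarith : a ≠ 0)
      have hχη : χ x = a * ((x ^ (a - 1) : ℝ) : ℂ) * η x := by
        simp only [hη]
        push_cast at hinv ⊢
        field_simp
        linear_combination -(χ x) * hinv
      rw [hχη]
      simp only [ofReal_sub, ofReal_mul, ofReal_one]
      ring
    have i1 : IntervalIntegrable (fun x => Complex.exp (I * (c * x - τ * x ^ a : ℝ)) * η x)
        volume (1 / 2) 4 := ((hcE c τ).mul hdη.continuous).intervalIntegrable _ _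
    have i2 : IntervalIntegrable (fun x => Complex.exp (I * (c * x - τ * x ^ a : ℝ)) * deriv η x)
        volume (1 / 2) 4 := ((hcE c τ).mul hdη'.continuous).intervalIntegrable _ _
    have i3 : IntervalIntegrable (fun x => Complex.exp (I * (c * x - τ * x ^ a : ℝ)) * χ x)
        volume (1 / 2) 4 := ((hcE c τ).mul hχ.continuous).intervalIntegrable _ _
    have hI := intervalIntegral.integral_eq_sub_of_hasDerivAt hder
      (((i1.const_mul _).add i2).sub (i3.const_mul _))
    rw [intervalIntegral.integral_sub ((i1.const_mul _).add i2) (i3.const_mul _),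
      intervalIntegral.integral_add (i1.const_mul _) i2, intervalIntegral.integral_const_mul,
      intervalIntegral.integral_const_mul, hzero 4 (by simp), hzero (1 / 2) (by simp), mul_zero,
      mul_zero, sub_zero, sub_eq_zero] at hI
    have hn := congrArg norm hI
    simp only [norm_mul, norm_I, one_mul, norm_real, Real.norm_eq_abs] at hn
    have hτ' : 0 < |τ| := abs_pos.2 hτ
    have hle : |τ| * ‖∫ x in (1 / 2 : ℝ)..4, Complex.exp (I * (c * x - τ * x ^ a : ℝ)) * χ x‖
        ≤ (C₁ + C₂) * (1 + |c|) * ((1 + |c|) / |τ|) ^ n := by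
      rw [← hn]
      refine (norm_add_le _ _).trans ?_
      simp only [norm_mul, norm_I, one_mul, norm_real, Real.norm_eq_abs]
      have hp : 0 ≤ ((1 + |c|) / |τ|) ^ n := by positivity
      have k1 := mul_le_mul_of_nonneg_left (h₁ c τ hτ) (abs_nonneg c)
      have k2 := h₂ c τ hτ
      have k3 : 0 ≤ C₁ * ((1 + |c|) / |τ|) ^ n := mul_nonneg hC₁ hp
      have k4 : 0 ≤ |c| * (C₂ * ((1 + |c|) / |τ|) ^ n) :=
        mul_nonneg (abs_nonneg c) (mul_nonneg hC₂ hp)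
      nlinarith
    rw [pow_succ, ← mul_assoc, mul_div_assoc', le_div_iff₀ hτ', mul_comm]
    refine hle.trans (le_of_eq ?_)
    ring

theorem circleBessel_eq_integral_cexp (v : ℝ) : (circleBessel v : ℂ) =
    ∫ θ in (0 : ℝ)..(2 * Real.pi), Complex.exp (I * (v * Real.cos θ : ℝ)) := by
  have hsin : ∫ θ in (0 : ℝ)..(2 * Real.pi), Real.sin (v * Real.cos θ) = 0 := by
    have hper : Function.Periodic (fun θ => Real.sin (v * Real.cos θ)) (2 * Real.pi) := fun θ => by
      simp
    have h1 := hper.intervalIntegral_add_eq Real.pi 0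
    have h2 := intervalIntegral.integral_comp_add_right (a := 0) (b := 2 * Real.pi)
      (fun θ => Real.sin (v * Real.cos θ)) Real.pi
    simp only [Real.cos_add_pi, mul_neg, Real.sin_neg, intervalIntegral.integral_neg,
      zero_add] at h2 h1
    rw [add_comm Real.pi] at h1
    linarith
  have hsplit : ∀ θ : ℝ, Complex.exp (I * (v * Real.cos θ : ℝ)) =
      ((Real.cos (v * Real.cos θ) : ℝ) : ℂ) + ((Real.sin (v * Real.cos θ) : ℝ) : ℂ) * I := by
    intro θ
    rw [mul_comm, Complex.exp_mul_I, ofReal_cos, ofReal_sin]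
  simp_rw [hsplit]
  rw [intervalIntegral.integral_add, intervalIntegral.integral_mul_const,
    intervalIntegral.integral_ofReal, intervalIntegral.integral_ofReal, hsin, circleBessel]
  · simp
  all_goals exact (by fun_prop : Continuous _).intervalIntegrable _ _

theorem abs_circleBessel_le (v : ℝ) : |circleBessel v| ≤ 2 * Real.pi := by
  have := intervalIntegral.norm_integral_le_of_norm_le_const (a := 0) (b := 2 * Real.pi) (C := 1)
    (f := fun θ => Real.cos (v * Real.cos θ)) fun θ _ => Real.abs_cos_le_one _
  rw [one_mul, sub_zero, abs_of_pos Real.two_pi_pos] at this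
  exact this

/-- Bounds against plane waves imply bounds against `circleBessel`. -/
theorem norm_integral_mul_circleBessel_le {h : ℝ → ℂ} (hh : Continuous h) {a b r B : ℝ}
    (hB : ∀ c : ℝ, |c| ≤ |r| → ‖∫ x in a..b, h x * Complex.exp (I * (c * x : ℝ))‖ ≤ B) :
    ‖∫ x in a..b, h x * circleBessel (x * r)‖ ≤ 2 * Real.pi * B := by
  have h1 : ∫ x in a..b, h x * circleBessel (x * r) =
      ∫ θ in (0 : ℝ)..(2 * Real.pi), ∫ x in a..b,
        h x * Complex.exp (I * (r * Real.cos θ * x : ℝ)) := by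
    rw [← intervalIntegral_intervalIntegral_swap]
    · refine intervalIntegral.integral_congr fun x _ => ?_
      simp only [circleBessel_eq_integral_cexp, ← intervalIntegral.integral_const_mul]
      refine intervalIntegral.integral_congr fun θ _ => ?_
      congr 4
      ring
    · have hc : Continuous (Function.uncurry fun x θ : ℝ =>
          h x * Complex.exp (I * (r * Real.cos θ * x : ℝ))) := by
        simp only [Function.uncurry_def]
        fun_prop
      exact (hc.continuousOn.integrableOn_compact (isCompact_uIcc.prod isCompact_uIcc)).mono_set
        (Set.prod_mono Set.uIoc_subset_uIcc Set.uIoc_subset_uIcc)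
  rw [h1]
  refine (intervalIntegral.norm_integral_le_of_norm_le_const (C := B) fun θ _ => ?_).trans
    (le_of_eq ?_)
  · refine hB _ ?_
    rw [abs_mul]
    exact mul_le_of_le_one_right (abs_nonneg r) (Real.abs_cos_le_one θ)
  · rw [sub_zero, abs_of_pos Real.two_pi_pos, mul_comm]

/-- The kernel of `T T*`, where `T` is the frequency localised radial propagator. -/
def besselKernel (a : ℝ) (χ : ℝ → ℂ) (τ r r' : ℝ) : ℂ :=
  ∫ x in (1 / 2 : ℝ)..4,
    Complex.exp (I * (-τ * x ^ a : ℝ)) * (χ x * circleBessel (x * r) * circleBessel (x * r'))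

theorem norm_besselKernel_le_nonstationary {a : ℝ} (ha : 1 < a) (n : ℕ) {χ : ℝ → ℂ}
    (hχ : ContDiff ℝ (⊤ : ℕ∞) χ) (hs : tsupport χ ⊆ Set.Ioo (1 / 2 : ℝ) 4) :
    ∃ C : ℝ, 0 ≤ C ∧ ∀ R τ r r' : ℝ, 1 ≤ R → τ ≠ 0 → |r| ≤ R → |r'| ≤ R →
      ‖besselKernel a χ τ r r'‖ ≤ C * (R / |τ|) ^ n := by
  obtain ⟨C, hC, h⟩ := norm_integral_nonstationary_le ha n χ hχ hs
  refine ⟨2 * Real.pi * (2 * Real.pi * (C * 3 ^ n)), by positivity, ?_⟩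
  intro R τ r r' hR hτ hr hr'
  have hrp : Continuous fun x : ℝ => x ^ a := continuous_id.rpow_const fun x => Or.inr (by linarith)
  have hχc := hχ.continuous
  have hJ := continuous_circleBessel
  have hmain : ‖∫ x in (1 / 2 : ℝ)..4, (Complex.exp (I * (-τ * x ^ a : ℝ)) * χ x
      * circleBessel (x * r)) * circleBessel (x * r')‖
      ≤ 2 * Real.pi * (2 * Real.pi * (C * 3 ^ n * (R / |τ|) ^ n)) := by
    refine norm_integral_mul_circleBessel_le (by fun_prop) fun c' hc' => ?_
    have e1 : ∀ x : ℝ, Complex.exp (I * (-τ * x ^ a : ℝ)) * χ x * circleBessel (x * r)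
        * Complex.exp (I * (c' * x : ℝ)) = Complex.exp (I * (-τ * x ^ a : ℝ)) * χ x
        * Complex.exp (I * (c' * x : ℝ)) * circleBessel (x * r) := fun x => by ring
    simp_rw [e1]
    refine norm_integral_mul_circleBessel_le (by fun_prop) fun c hc => ?_
    have e2 : ∀ x : ℝ, Complex.exp (I * (-τ * x ^ a : ℝ)) * χ x * Complex.exp (I * (c' * x : ℝ))
        * Complex.exp (I * (c * x : ℝ)) =
        Complex.exp (I * ((c + c') * x - τ * x ^ a : ℝ)) * χ x := fun x => by
      rw [mul_right_comm _ (χ x), mul_right_comm _ (χ x), ← Complex.exp_add, ← Complex.exp_add]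
      congr 2
      push_cast
      ring
    simp_rw [e2]
    refine (h (c + c') τ hτ).trans ?_
    rw [mul_assoc, ← mul_pow, mul_div_assoc']
    have h3 : 1 + |c + c'| ≤ 3 * R := by
      have := abs_add_le c c'
      linarith
    gcongr
  calc ‖besselKernel a χ τ r r'‖ = _ := by
        rw [besselKernel]
        congr 1
        refine intervalIntegral.integral_congr fun x _ => ?_
        ring
    _ ≤ _ := hmain
    _ = _ := by ring

/-- Amplitudes of symbol type on `[1/2, ∞)`. -/
def IsSymbol (C : ℝ) (β β' : ℝ → ℂ) : Prop :=
  (∀ v, 0 < v → HasDerivAt β (β' v) v) ∧ ContinuousOn β' (Set.Ioi 0) ∧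
    ∀ v, 1 / 2 ≤ v → ‖β v‖ ≤ C ∧ ‖β' v‖ ≤ C / v ^ 2

theorem IsSymbol.norm_integral_le {a C : ℝ} (ha : 1 < a) (ha2 : a < 2) (hC : 0 < C) {χ : ℝ → ℂ}
    (hχ : ContDiff ℝ (⊤ : ℕ∞) χ) {β β' γ γ' : ℝ → ℂ} (hβ : IsSymbol C β β')
    (hγ : IsSymbol C γ γ') :
    ∃ D : ℝ, 0 < D ∧ ∀ c τ r r' : ℝ, τ ≠ 0 → 1 ≤ r → 1 ≤ r' →
      ‖∫ x in (1 / 2 : ℝ)..4, Complex.exp (I * (c * x - τ * x ^ a : ℝ))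
        * (χ x * (β (x * r) * γ (x * r')))‖ ≤ D / √|τ| := by
  obtain ⟨D, hD, h⟩ := norm_integral_dispersive_le ha ha2
  have hχ' : Continuous (deriv χ) := hχ.continuous_deriv (by simp)
  obtain ⟨M₀, hM₀⟩ := isCompact_Icc.exists_bound_of_continuousOn (s := Set.Icc (1 / 2 : ℝ) 4)
    hχ.continuous.continuousOn
  obtain ⟨M₁, hM₁⟩ := isCompact_Icc.exists_bound_of_continuousOn (s := Set.Icc (1 / 2 : ℝ) 4)
    hχ'.continuousOn
  have hM₀0 : 0 ≤ M₀ := (norm_nonneg _).trans (hM₀ 1 (by norm_num))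
  have hM₁0 : 0 ≤ M₁ := (norm_nonneg _).trans (hM₁ 1 (by norm_num))
  set M : ℝ := M₁ * C ^ 2 + M₀ * (8 * C ^ 2) + M₀ * C ^ 2 with hM
  refine ⟨D * (M + 1), by positivity, fun c τ r r' hτ hr hr' => ?_⟩
  have hv : ∀ x ∈ Set.Icc (1 / 2 : ℝ) 4, ∀ ρ : ℝ, 1 ≤ ρ → 1 / 2 ≤ x * ρ := fun x hx ρ hρ => by
    nlinarith [hx.1]
  have hder : ∀ {β β' : ℝ → ℂ}, IsSymbol C β β' → ∀ x ∈ Set.Icc (1 / 2 : ℝ) 4, ∀ ρ : ℝ, 1 ≤ ρ →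
      HasDerivAt (fun x => β (x * ρ)) (ρ * β' (x * ρ)) x := by
    intro β β' hβ x hx ρ hρ
    have h1 := hβ.1 (x * ρ) (lt_of_lt_of_le (by norm_num) (hv x hx ρ hρ))
    have h2 := HasDerivAt.scomp x h1 ((hasDerivAt_id x).mul_const ρ)
    simpa [Function.comp_def] using h2
  have hbd : ∀ {β β' : ℝ → ℂ}, IsSymbol C β β' → ∀ x ∈ Set.Icc (1 / 2 : ℝ) 4, ∀ ρ : ℝ, 1 ≤ ρ →
      ‖(ρ : ℂ) * β' (x * ρ)‖ ≤ 4 * C := by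
    intro β β' hβ x hx ρ hρ
    have hx0 : 0 < x := lt_of_lt_of_le (by norm_num) hx.1
    rw [norm_mul, norm_real, Real.norm_of_nonneg (by linarith)]
    refine (mul_le_mul_of_nonneg_left (hβ.2.2 _ (hv x hx ρ hρ)).2 (by linarith)).trans ?_
    rw [mul_div_assoc', div_le_iff₀ (by positivity)]
    have h1 : 1 ≤ 4 * x ^ 2 := by nlinarith [hx.1]
    have h2 : ρ ≤ ρ ^ 2 := by nlinarith
    have h3 : ρ * C ≤ ρ ^ 2 * C := by gcongr
    have h4 : 1 * (ρ ^ 2 * C) ≤ 4 * x ^ 2 * (ρ ^ 2 * C) := by gcongr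
    calc ρ * C ≤ 4 * x ^ 2 * (ρ ^ 2 * C) := by linarith
      _ = _ := by ring
  have hcont : ∀ {β β' : ℝ → ℂ}, IsSymbol C β β' → ∀ ρ : ℝ, 1 ≤ ρ →
      ContinuousOn (fun x : ℝ => (ρ : ℂ) * β' (x * ρ)) (Set.Icc (1 / 2 : ℝ) 4) := by
    intro β β' hβ ρ hρ
    refine continuousOn_const.mul (hβ.2.1.comp (by fun_prop) fun x hx => ?_)
    exact Set.mem_Ioi.2 (lt_of_lt_of_le (by norm_num) (hv x hx ρ hρ))
  refine (h c τ (M + 1) (fun x => χ x * (β (x * r) * γ (x * r')))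
    (fun x => deriv χ x * (β (x * r) * γ (x * r'))
      + χ x * (r * β' (x * r) * γ (x * r') + β (x * r) * (r' * γ' (x * r')))) hτ
    (by positivity) (fun x hx => ?_) ?_ (fun x hx => ?_) (fun x hx => ?_)).trans
    (le_of_eq (by ring))
  · exact (hχ.differentiable (by simp) x).hasDerivAt.mul
      ((hder hβ x hx r hr).mul (hder hγ x hx r' hr'))
  · have c1 : ContinuousOn (fun x => β (x * r)) (Set.Icc (1 / 2 : ℝ) 4) := fun x hx =>
      (hder hβ x hx r hr).continuousAt.continuousWithinAt
    have c2 : ContinuousOn (fun x => γ (x * r')) (Set.Icc (1 / 2 : ℝ) 4) := fun x hx =>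
      (hder hγ x hx r' hr').continuousAt.continuousWithinAt
    exact (hχ'.continuousOn.mul (c1.mul c2)).add (hχ.continuous.continuousOn.mul
      (((hcont hβ r hr).mul c2).add (c1.mul (hcont hγ r' hr'))))
  · have b1 := (hβ.2.2 _ (hv x hx r hr)).1
    have b2 := (hγ.2.2 _ (hv x hx r' hr')).1
    have : ‖χ x * (β (x * r) * γ (x * r'))‖ ≤ M₀ * (C * C) := by
      rw [norm_mul, norm_mul]
      have := hM₀ x hx
      gcongr
    refine this.trans ?_
    rw [hM]
    nlinarith [mul_nonneg hM₁0 (sq_nonneg C), mul_nonneg hM₀0 (sq_nonneg C)]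
  · have b1 := (hβ.2.2 _ (hv x hx r hr)).1
    have b2 := (hγ.2.2 _ (hv x hx r' hr')).1
    have d1 := hbd hβ x hx r hr
    have d2 := hbd hγ x hx r' hr'
    have m0 := hM₀ x hx
    have m1 := hM₁ x hx
    have k1 : ‖deriv χ x * (β (x * r) * γ (x * r'))‖ ≤ M₁ * (C * C) := by
      rw [norm_mul, norm_mul]
      gcongr
    have k2 : ‖χ x * (r * β' (x * r) * γ (x * r') + β (x * r) * (r' * γ' (x * r')))‖
        ≤ M₀ * (4 * C * C + C * (4 * C)) := by
      rw [norm_mul]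
      refine mul_le_mul m0 ((norm_add_le _ _).trans ?_) (norm_nonneg _) hM₀0
      rw [norm_mul _ (γ (x * r')), norm_mul (β (x * r))]
      gcongr
    refine (norm_add_le _ _).trans ?_
    rw [hM]
    nlinarith [mul_nonneg hM₀0 (sq_nonneg C)]

theorem norm_besselKernel_le_stationary {a : ℝ} (ha : 1 < a) (ha2 : a < 2) {χ : ℝ → ℂ}
    (hχ : ContDiff ℝ (⊤ : ℕ∞) χ) (hs : tsupport χ ⊆ Set.Ioo (1 / 2 : ℝ) 4) :
    ∃ D : ℝ, 0 < D ∧ ∀ τ r r' : ℝ, τ ≠ 0 → 1 ≤ r → 1 ≤ r' →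
      ‖besselKernel a χ τ r r'‖ ≤ D / (√r * √r' * √|τ|) := by
  obtain ⟨C, hC, hamp⟩ := besselAmp_bounded
  set χ₁ : ℝ → ℂ := fun x => χ x * ((x⁻¹ : ℝ) : ℂ) with hχ₁
  have hχ₁d : ContDiff ℝ (⊤ : ℕ∞) χ₁ := contDiff_mul_of_tsupport_subset hχ hs fun x hx =>
    Complex.ofRealCLM.contDiff.contDiffAt.comp x (contDiffAt_id.inv hx.ne')
  set b : ℝ → ℂ := besselAmp with hb
  set b' : ℝ → ℂ := fun v => I * besselW v / (8 * v ^ 2) * Complex.exp (-(I * v)) with hb'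
  have hsym : IsSymbol C b b' := by
    refine ⟨fun v hv => hasDerivAt_besselAmp hv, ?_, hamp⟩
    have hW : ContinuousOn besselW (Set.Ioi 0) := fun v hv =>
      (hasDerivAt_besselW hv).continuousAt.continuousWithinAt
    refine ContinuousOn.mul (ContinuousOn.div (continuousOn_const.mul
      (Complex.continuous_ofReal.comp_continuousOn hW)) (by fun_prop) fun v hv => ?_) (by fun_prop)
    have : (v : ℂ) ≠ 0 := by exact_mod_cast (Set.mem_Ioi.1 hv).ne'
    simpa using this
  have hsymc : IsSymbol C (fun v => (starRingEnd ℂ) (b v)) (fun v => (starRingEnd ℂ) (b' v)) := by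
    refine ⟨fun v hv => by simpa using (hsym.1 v hv).star,
      Complex.continuous_conj.comp_continuousOn hsym.2.1, fun v hv => ?_⟩
    simpa using hsym.2.2 v hv
  obtain ⟨D₁, hD₁, h₁⟩ := hsym.norm_integral_le ha ha2 hC hχ₁d hsym
  obtain ⟨D₂, hD₂, h₂⟩ := hsym.norm_integral_le ha ha2 hC hχ₁d hsymc
  obtain ⟨D₃, hD₃, h₃⟩ := hsymc.norm_integral_le ha ha2 hC hχ₁d hsym
  obtain ⟨D₄, hD₄, h₄⟩ := hsymc.norm_integral_le ha ha2 hC hχ₁d hsymc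
  refine ⟨D₁ + D₂ + D₃ + D₄, by positivity, fun τ r r' hτ hr hr' => ?_⟩
  have hrp : Continuous fun x : ℝ => x ^ a := continuous_id.rpow_const fun x => Or.inr (by linarith)
  have hcb : ∀ {β β' : ℝ → ℂ}, IsSymbol C β β' → ∀ ρ : ℝ, 1 ≤ ρ →
      ContinuousOn (fun x : ℝ => β (x * ρ)) (Set.uIcc (1 / 2 : ℝ) 4) := by
    intro β β' hβ ρ hρ x hx
    rw [Set.uIcc_of_le (by norm_num)] at hx
    have hpos : 0 < x * ρ := mul_pos (lt_of_lt_of_le (by norm_num) hx.1) (by linarith)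
    have h2 := HasDerivAt.scomp x (hβ.1 _ hpos) ((hasDerivAt_id x).mul_const ρ)
    exact h2.continuousAt.continuousWithinAt
  have hintg : ∀ {β β' γ γ' : ℝ → ℂ}, IsSymbol C β β' → IsSymbol C γ γ' → ∀ c : ℝ,
      IntervalIntegrable (fun x : ℝ => Complex.exp (I * (c * x - τ * x ^ a : ℝ))
        * (χ₁ x * (β (x * r) * γ (x * r')))) volume (1 / 2) 4 := by
    intro β β' γ γ' hβ hγ c
    refine ContinuousOn.intervalIntegrable ?_
    exact (by fun_prop : Continuous fun x : ℝ =>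
      Complex.exp (I * (c * x - τ * x ^ a : ℝ))).continuousOn.mul
      (hχ₁d.continuous.continuousOn.mul ((hcb hβ r hr).mul (hcb hγ r' hr')))
  have hr0 : 0 < √r := Real.sqrt_pos.2 (by linarith)
  have hr0' : 0 < √r' := Real.sqrt_pos.2 (by linarith)
  have hJ : ∀ x ∈ Set.Icc (1 / 2 : ℝ) 4, ∀ ρ : ℝ, 1 ≤ ρ →
      (circleBessel (x * ρ) : ℂ) = ((√x * √ρ : ℝ) : ℂ)⁻¹ *
        (b (x * ρ) * Complex.exp (I * (ρ * x : ℝ))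
          + (starRingEnd ℂ) (b (x * ρ)) * Complex.exp (I * (-ρ * x : ℝ))) := by
    intro x hx ρ hρ
    have hx0 : 0 < x := lt_of_lt_of_le (by norm_num) hx.1
    have h1 := besselW_eq (x * ρ)
    have h2 : 0 < √x * √ρ := mul_pos (Real.sqrt_pos.2 hx0) (Real.sqrt_pos.2 (by linarith))
    rw [eq_inv_mul_iff_mul_eq₀ (by exact_mod_cast h2.ne'), ← ofReal_mul, ← Real.sqrt_mul hx0.le]
    have e1 : Complex.exp (I * (ρ * x : ℝ)) = Complex.exp (I * (x * ρ : ℝ)) := by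
      rw [mul_comm ρ x]
    have e2 : Complex.exp (I * (-ρ * x : ℝ)) = Complex.exp (-(I * (x * ρ : ℝ))) := by
      congr 1
      push_cast
      ring
    rw [e1, e2]
    exact h1
  have hexp : ∀ c c' x : ℝ, Complex.exp (I * ((c + c') * x - τ * x ^ a : ℝ)) =
      Complex.exp (I * (-τ * x ^ a : ℝ)) * Complex.exp (I * (c * x : ℝ))
        * Complex.exp (I * (c' * x : ℝ)) := by
    intro c c' x
    rw [← Complex.exp_add, ← Complex.exp_add]
    congr 1
    push_cast
    ring
  have hK : besselKernel a χ τ r r' = ((√r * √r' : ℝ) : ℂ)⁻¹ *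
      ((∫ x in (1 / 2 : ℝ)..4, Complex.exp (I * ((r + r') * x - τ * x ^ a : ℝ))
          * (χ₁ x * (b (x * r) * b (x * r'))))
      + (∫ x in (1 / 2 : ℝ)..4, Complex.exp (I * ((r + -r') * x - τ * x ^ a : ℝ))
          * (χ₁ x * (b (x * r) * (starRingEnd ℂ) (b (x * r')))))
      + (∫ x in (1 / 2 : ℝ)..4, Complex.exp (I * ((-r + r') * x - τ * x ^ a : ℝ))
          * (χ₁ x * ((starRingEnd ℂ) (b (x * r)) * b (x * r'))))
      + (∫ x in (1 / 2 : ℝ)..4, Complex.exp (I * ((-r + -r') * x - τ * x ^ a : ℝ))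
          * (χ₁ x * ((starRingEnd ℂ) (b (x * r)) * (starRingEnd ℂ) (b (x * r')))))) := by
    rw [← intervalIntegral.integral_add (hintg hsym hsym _) (hintg hsym hsymc _),
      ← intervalIntegral.integral_add ((hintg hsym hsym _).add (hintg hsym hsymc _))
        (hintg hsymc hsym _),
      ← intervalIntegral.integral_add (((hintg hsym hsym _).add (hintg hsym hsymc _)).add
        (hintg hsymc hsym _)) (hintg hsymc hsymc _),
      ← intervalIntegral.integral_const_mul, besselKernel]
    refine intervalIntegral.integral_congr fun x hx => ?_
    rw [Set.uIcc_of_le (by norm_num)] at hx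
    have hx0 : 0 < x := lt_of_lt_of_le (by norm_num) hx.1
    simp only [hJ x hx r hr, hJ x hx r' hr', hexp, hχ₁]
    have hxx : ((x⁻¹ : ℝ) : ℂ) = ((√x : ℝ) : ℂ)⁻¹ * ((√x : ℝ) : ℂ)⁻¹ := by
      rw [← mul_inv, ← ofReal_mul, Real.mul_self_sqrt hx0.le, ofReal_inv]
    simp only [hxx, ofReal_mul (√x), ofReal_mul (√r), mul_inv]
    ring
  rw [hK, norm_mul, norm_inv, norm_real, Real.norm_of_nonneg (by positivity), inv_mul_le_iff₀
    (by positivity)]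
  refine (norm_add₄_le).trans ((add_le_add (add_le_add (add_le_add (h₁ _ τ r r' hτ hr hr')
    (h₂ _ τ r r' hτ hr hr')) (h₃ _ τ r r' hτ hr hr')) (h₄ _ τ r r' hτ hr hr')).trans
    (le_of_eq ?_))
  have : √|τ| ≠ 0 := (Real.sqrt_pos.2 (abs_pos.2 hτ)).ne'
  field_simp

/-- An integrable majorant of the kernels. -/
def decayMajorant (τ : ℝ) : ℝ :=
  ((Set.Ioc (0 : ℝ) 1).indicator (fun x => x ^ (-(1 / 2) : ℝ)) τ
    + (Set.Ioi (1 : ℝ)).indicator (fun x => x ^ (-(13 / 12) : ℝ)) τ)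
  + ((Set.Ioc (0 : ℝ) 1).indicator (fun x => x ^ (-(1 / 2) : ℝ)) (-τ)
    + (Set.Ioi (1 : ℝ)).indicator (fun x => x ^ (-(13 / 12) : ℝ)) (-τ))

theorem integrable_decayMajorant : Integrable decayMajorant := by
  have h1 : Integrable ((Set.Ioc (0 : ℝ) 1).indicator fun x : ℝ => x ^ (-(1 / 2) : ℝ)) := by
    rw [integrable_indicator_iff measurableSet_Ioc, ← intervalIntegrable_iff_integrableOn_Ioc_of_le
      zero_le_one]
    exact intervalIntegral.intervalIntegrable_rpow' (by norm_num)
  have h2 : Integrable ((Set.Ioi (1 : ℝ)).indicator fun x : ℝ => x ^ (-(13 / 12) : ℝ)) := by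
    rw [integrable_indicator_iff measurableSet_Ioi]
    exact integrableOn_Ioi_rpow_of_lt (by norm_num) one_pos
  exact (h1.add h2).add (h1.add h2).comp_neg

theorem decayMajorant_nonneg (τ : ℝ) : 0 ≤ decayMajorant τ := by
  have h1 : ∀ τ : ℝ, 0 ≤ (Set.Ioc (0 : ℝ) 1).indicator (fun x => x ^ (-(1 / 2) : ℝ)) τ :=
    Set.indicator_nonneg fun x hx => Real.rpow_nonneg hx.1.le _
  have h2 : ∀ τ : ℝ, 0 ≤ (Set.Ioi (1 : ℝ)).indicator (fun x => x ^ (-(13 / 12) : ℝ)) τ :=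
    Set.indicator_nonneg fun x hx => Real.rpow_nonneg (zero_le_one.trans (Set.mem_Ioi.1 hx).le) _
  exact add_nonneg (add_nonneg (h1 _) (h2 _)) (add_nonneg (h1 _) (h2 _))

theorem decayMajorant_abs (τ : ℝ) : decayMajorant |τ| = decayMajorant τ := by
  rcases abs_choice τ with h | h <;> rw [h]
  simp only [decayMajorant, neg_neg]
  ring

theorem decayMajorant_of_le_one {τ : ℝ} (h0 : 0 < τ) (h1 : τ ≤ 1) :
    decayMajorant τ = τ ^ (-(1 / 2) : ℝ) := by
  simp [decayMajorant, Set.indicator, h0, h1, not_lt.2 h1, not_lt.2 h0.le,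
    not_lt.2 (by linarith : -τ ≤ 1)]

theorem decayMajorant_of_one_lt {τ : ℝ} (h1 : 1 < τ) :
    decayMajorant τ = τ ^ (-(13 / 12) : ℝ) := by
  have h0 : 0 < τ := by linarith
  simp [decayMajorant, Set.indicator, h0, h1, not_le.2 h1, not_lt.2 h0.le,
    not_lt.2 (by linarith : -τ ≤ 1)]

/-- Kernel bounds for positions in the unit interval and in dyadic annuli. -/
theorem norm_besselKernel_le {a : ℝ} (ha : 1 < a) (ha2 : a < 2) {χ : ℝ → ℂ}
    (hχ : ContDiff ℝ (⊤ : ℕ∞) χ) (hs : tsupport χ ⊆ Set.Ioo (1 / 2 : ℝ) 4) :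
    ∃ C : ℝ, 0 < C ∧ (∀ τ r r' : ℝ, τ ≠ 0 → r ∈ Set.Icc (0 : ℝ) 1 → r' ∈ Set.Icc (0 : ℝ) 1 →
        ‖besselKernel a χ τ r r'‖ ≤ C * decayMajorant τ) ∧
      ∀ R τ r r' : ℝ, 1 ≤ R → τ ≠ 0 → r ∈ Set.Icc R (2 * R) → r' ∈ Set.Icc R (2 * R) →
        ‖besselKernel a χ τ r r'‖ ≤ C * R ^ (-(1 / 6) : ℝ) * decayMajorant τ := by
  obtain ⟨D, hD, hst⟩ := norm_besselKernel_le_stationary ha ha2 hχ hs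
  obtain ⟨C₀, hC₀, hns₀⟩ := norm_besselKernel_le_nonstationary ha 0 hχ hs
  obtain ⟨C₄, hC₄, hns₄⟩ := norm_besselKernel_le_nonstationary ha 4 hχ hs
  set B : ℝ := D + C₀ + 16 * C₄ with hB
  have hB0 : 0 < B := by positivity
  refine ⟨B, hB0, fun τ r r' hτ hr hr' => ?_, fun R τ r r' hR hτ hr hr' => ?_⟩
  · have hr1 : |r| ≤ 1 := by rw [abs_of_nonneg hr.1]; exact hr.2
    have hr1' : |r'| ≤ 1 := by rw [abs_of_nonneg hr'.1]; exact hr'.2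
    have hT : 0 < |τ| := abs_pos.2 hτ
    rw [← decayMajorant_abs]
    rcases le_or_gt |τ| 1 with h | h
    · rw [decayMajorant_of_le_one hT h]
      have h1 := hns₀ 1 τ r r' le_rfl hτ hr1 hr1'
      have h2 : 1 ≤ |τ| ^ (-(1 / 2) : ℝ) := Real.one_le_rpow_of_pos_of_le_one_of_nonpos hT h
        (by norm_num)
      rw [pow_zero, mul_one] at h1
      nlinarith
    · rw [decayMajorant_of_one_lt h]
      have h1 := hns₄ 1 τ r r' le_rfl hτ hr1 hr1'
      have h2 : (1 / |τ|) ^ 4 ≤ |τ| ^ (-(13 / 12) : ℝ) := by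
        rw [one_div, inv_pow, ← Real.rpow_natCast, ← Real.rpow_neg hT.le]
        exact Real.rpow_le_rpow_of_exponent_le h.le (by norm_num)
      have h3 : 0 ≤ (1 / |τ|) ^ 4 := by positivity
      refine h1.trans (mul_le_mul (by linarith) h2 h3 hB0.le)
  · have hR0 : 0 < R := by linarith
    have hT : 0 < |τ| := abs_pos.2 hτ
    have k1 : ‖besselKernel a χ τ r r'‖ ≤ B * (R ^ (-1 : ℝ) * |τ| ^ (-(1 / 2) : ℝ)) := by
      refine (hst τ r r' hτ (hR.trans hr.1) (hR.trans hr'.1)).trans ?_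
      have h1 : R ≤ √r * √r' := by
        calc R = √R * √R := (Real.mul_self_sqrt hR0.le).symm
          _ ≤ √r * √r' := mul_le_mul (Real.sqrt_le_sqrt hr.1) (Real.sqrt_le_sqrt hr'.1)
            (Real.sqrt_nonneg _) (Real.sqrt_nonneg _)
      have h2 : R ^ (-1 : ℝ) * |τ| ^ (-(1 / 2) : ℝ) = 1 / (R * √|τ|) := by
        rw [Real.rpow_neg_one, Real.rpow_neg hT.le, ← Real.sqrt_eq_rpow, one_div, mul_inv]
      rw [h2, mul_one_div]
      have h3 : 0 < √|τ| := Real.sqrt_pos.2 hT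
      gcongr
      linarith
    have k2 : ‖besselKernel a χ τ r r'‖ ≤ B * (R ^ (4 : ℝ) * |τ| ^ (-4 : ℝ)) := by
      refine (hns₄ (2 * R) τ r r' (by linarith) hτ (by rw [abs_of_nonneg] <;> linarith [hr.1, hr.2])
        (by rw [abs_of_nonneg] <;> linarith [hr'.1, hr'.2])).trans ?_
      have h2 : R ^ (4 : ℝ) * |τ| ^ (-4 : ℝ) = (R / |τ|) ^ 4 := by
        rw [Real.rpow_neg hT.le, div_pow, ← Real.rpow_natCast, ← Real.rpow_natCast]
        norm_num
        rfl
      rw [h2]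
      have : C₄ * (2 * R / |τ|) ^ 4 = 16 * C₄ * (R / |τ|) ^ 4 := by ring
      rw [this]
      gcongr
      linarith
    rw [← decayMajorant_abs]
    rcases le_or_gt |τ| 1 with h | h
    · rw [decayMajorant_of_le_one hT h, mul_assoc]
      refine k1.trans ?_
      gcongr
      norm_num
    · rw [decayMajorant_of_one_lt h]
      have hn := norm_nonneg (besselKernel a χ τ r r')
      calc ‖besselKernel a χ τ r r'‖
          = ‖besselKernel a χ τ r r'‖ ^ (5 / 6 : ℝ) * ‖besselKernel a χ τ r r'‖ ^ (1 / 6 : ℝ) := by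
            rw [← Real.rpow_add_of_nonneg hn (by norm_num) (by norm_num)]
            norm_num
        _ ≤ (B * (R ^ (-1 : ℝ) * |τ| ^ (-(1 / 2) : ℝ))) ^ (5 / 6 : ℝ)
            * (B * (R ^ (4 : ℝ) * |τ| ^ (-4 : ℝ))) ^ (1 / 6 : ℝ) := by gcongr
        _ = (B ^ (5 / 6 : ℝ) * B ^ (1 / 6 : ℝ)) *
            ((R ^ (-1 : ℝ)) ^ (5 / 6 : ℝ) * (R ^ (4 : ℝ)) ^ (1 / 6 : ℝ)) *
            ((|τ| ^ (-(1 / 2) : ℝ)) ^ (5 / 6 : ℝ) * (|τ| ^ (-4 : ℝ)) ^ (1 / 6 : ℝ)) := by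
            rw [Real.mul_rpow hB0.le (by positivity), Real.mul_rpow hB0.le (by positivity),
              Real.mul_rpow (by positivity) (by positivity),
              Real.mul_rpow (by positivity) (by positivity)]
            ring
        _ = B * R ^ (-(1 / 6) : ℝ) * |τ| ^ (-(13 / 12) : ℝ) := by
            simp only [← Real.rpow_mul hR0.le, ← Real.rpow_mul hT.le, ← Real.rpow_add hB0,
              ← Real.rpow_add hR0, ← Real.rpow_add hT]
            norm_num

/-- The `T T*` method with a Schur-type kernel bound, for bounded data on finite measure spaces. -/
theorem integral_norm_sq_le_of_kernel_bound {X T : Type*} [MeasurableSpace X] [MeasurableSpace T]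
    (μ : Measure T) [IsFiniteMeasure μ] (ν : Measure X) [IsFiniteMeasure ν] {Φ : T → X → ℂ}
    (hΦ : Measurable (Function.uncurry Φ)) {B : ℝ} (hB : ∀ t x, ‖Φ t x‖ ≤ B)
    {g : X → ℂ} (hg : Measurable g) {D : ℝ} (hD : ∀ x, ‖g x‖ ≤ D)
    {χ : X → ℝ} (hχ : Measurable χ) {E : ℝ} (hE : ∀ x, |χ x| ≤ E) (hχ0 : ∀ x, 0 ≤ χ x)
    (hgχ : ∀ x, g x ≠ 0 → 1 ≤ χ x) {k : T → T → ℝ} (hk0 : ∀ t t', 0 ≤ k t t')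
    (hk : Integrable (Function.uncurry k) (μ.prod μ))
    (hkΦ : ∀ᵐ p ∂(μ.prod μ),
      ‖∫ x, (χ x : ℂ) * (Φ p.1 x * (starRingEnd ℂ) (Φ p.2 x)) ∂ν‖ ≤ k p.1 p.2)
    {κ : ℝ} (hκ : 0 < κ) (hk1 : ∀ t, ∫ t', k t t' ∂μ ≤ κ) (hk2 : ∀ t', ∫ t, k t t' ∂μ ≤ κ) :
    ∫ t, ‖∫ x, g x * Φ t x ∂ν‖ ^ 2 ∂μ ≤ κ * ∫ x, ‖g x‖ ^ 2 ∂ν := by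
  set H : T → ℂ := fun t => ∫ x, g x * Φ t x ∂ν with hH
  set w : T → ℂ := fun t => (starRingEnd ℂ) (H t) with hw
  set W : X → ℂ := fun x => ∫ t, w t * Φ t x ∂μ with hW
  have hgΦ : Measurable fun p : T × X => g p.2 * Φ p.1 p.2 := (hg.comp measurable_snd).mul hΦ
  have hHm : Measurable H :=
    (hgΦ.stronglyMeasurable.integral_prod_right' (f := fun p : T × X => g p.2 * Φ p.1 p.2)).measurable
  have hwm : Measurable w := Complex.continuous_conj.measurable.comp hHm
  have hbd : ∀ t x, ‖g x * Φ t x‖ ≤ D * B := fun t x => by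
    rw [norm_mul]
    exact mul_le_mul (hD x) (hB t x) (norm_nonneg _) ((norm_nonneg _).trans (hD x))
  set b : ℝ := D * B * ν.real Set.univ with hb
  have hHb : ∀ t, ‖H t‖ ≤ b := fun t =>
    norm_integral_le_of_norm_le_const (Filter.Eventually.of_forall (hbd t))
  have hwb : ∀ t, ‖w t‖ ≤ b := fun t => by simpa [hw] using hHb t
  have hwn : ∀ t, ‖w t‖ = ‖H t‖ := fun t => RCLike.norm_conj _
  have hwH : ∀ t, w t * H t = ((‖H t‖ ^ 2 : ℝ) : ℂ) := fun t => by
    rw [hw, ← Complex.normSq_eq_conj_mul_self, Complex.normSq_eq_norm_sq]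
  clear_value w b
  have hwΦ : Measurable fun p : T × X => w p.1 * Φ p.1 p.2 := (hwm.comp measurable_fst).mul hΦ
  have hwΦ' : Measurable fun p : X × T => w p.2 * Φ p.2 p.1 := hwΦ.comp measurable_swap
  have hWm : Measurable W :=
    (hwΦ'.stronglyMeasurable.integral_prod_right' (f := fun p : X × T => w p.2 * Φ p.2 p.1)).measurable
  have hwΦb : ∀ t x, ‖w t * Φ t x‖ ≤ b * B := fun t x => by
    rw [norm_mul]
    exact mul_le_mul (hwb t) (hB t x) (norm_nonneg _) ((norm_nonneg _).trans (hwb t))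
  have hWb : ∀ x, ‖W x‖ ≤ b * B * μ.real Set.univ := fun x =>
    norm_integral_le_of_norm_le_const (Filter.Eventually.of_forall fun t => hwΦb t x)
  set A : ℝ := ∫ t, ‖H t‖ ^ 2 ∂μ with hA
  set G : ℝ := ∫ x, ‖g x‖ ^ 2 ∂ν with hG
  have hAw : A = ∫ t, ‖w t‖ ^ 2 ∂μ := by simp only [hA, hwn]
  have hwsq : Integrable (fun t => ‖w t‖ ^ 2) μ :=
    Integrable.of_bound (hwm.norm.pow_const 2).aestronglyMeasurable (b ^ 2)
      (Filter.Eventually.of_forall fun t => by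
        rw [Real.norm_of_nonneg (by positivity)]
        exact pow_le_pow_left₀ (norm_nonneg _) (hwb t) 2)
  have hA0 : 0 ≤ A := integral_nonneg fun t => by positivity
  have hAW : (A : ℂ) = ∫ x, g x * W x ∂ν := by
    have h1 : (A : ℂ) = ∫ t, ∫ x, w t * (g x * Φ t x) ∂ν ∂μ := by
      rw [hA, ← integral_complex_ofReal]
      refine integral_congr_ae (Filter.Eventually.of_forall fun t => ?_)
      simp only [integral_const_mul]
      exact (hwH t).symm
    rw [h1, integral_integral_swap]
    · refine integral_congr_ae (Filter.Eventually.of_forall fun x => ?_)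
      simp only [hW, ← integral_const_mul]
      exact integral_congr_ae (Filter.Eventually.of_forall fun t => by ring)
    · refine Integrable.of_bound (C := b * (D * B))
        ((hwm.comp measurable_fst).mul hgΦ).aestronglyMeasurable
        (Filter.Eventually.of_forall fun p => ?_)
      simp only [Function.uncurry, norm_mul (w p.1)]
      exact mul_le_mul (hwb p.1) (hbd p.1 p.2) (norm_nonneg _) ((norm_nonneg _).trans (hwb p.1))
  have hWW : ((∫ x, χ x * ‖W x‖ ^ 2 ∂ν : ℝ) : ℂ) = ∫ p, w p.1 * (starRingEnd ℂ) (w p.2) *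
      ∫ x, (χ x : ℂ) * (Φ p.1 x * (starRingEnd ℂ) (Φ p.2 x)) ∂ν ∂(μ.prod μ) := by
    have h1 : ((∫ x, χ x * ‖W x‖ ^ 2 ∂ν : ℝ) : ℂ) = ∫ x, ∫ p : T × T,
        (χ x : ℂ) * ((w p.1 * Φ p.1 x) * (starRingEnd ℂ) (w p.2 * Φ p.2 x)) ∂(μ.prod μ) ∂ν := by
      rw [← integral_complex_ofReal]
      refine integral_congr_ae (Filter.Eventually.of_forall fun x => ?_)
      simp only [integral_const_mul]
      rw [integral_prod_mul (fun t => w t * Φ t x) (fun t => (starRingEnd ℂ) (w t * Φ t x)),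
        integral_conj, Complex.mul_conj, Complex.normSq_eq_norm_sq]
      push_cast
      rfl
    rw [h1, integral_integral_swap]
    · refine integral_congr_ae (Filter.Eventually.of_forall fun p => ?_)
      simp only [← integral_const_mul]
      refine integral_congr_ae (Filter.Eventually.of_forall fun x => ?_)
      simp only [map_mul]
      ring
    · refine Integrable.of_bound (C := E * ((b * B) * (b * B))) ?_
        (Filter.Eventually.of_forall fun p => ?_)
      · refine Measurable.aestronglyMeasurable ?_
        have m1 : Measurable fun q : X × T × T => w q.2.1 * Φ q.2.1 q.1 :=
          hwΦ.comp (by fun_prop : Measurable fun q : X × T × T => (q.2.1, q.1))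
        have m2 : Measurable fun q : X × T × T => w q.2.2 * Φ q.2.2 q.1 :=
          hwΦ.comp (by fun_prop : Measurable fun q : X × T × T => (q.2.2, q.1))
        exact (Complex.measurable_ofReal.comp (hχ.comp measurable_fst)).mul
          (m1.mul (Complex.continuous_conj.measurable.comp m2))
      · simp only [Function.uncurry]
        rw [norm_mul, norm_mul, RCLike.norm_conj, norm_real]
        have := hwΦb p.2.1 p.1
        exact mul_le_mul (hE _) (mul_le_mul this (hwΦb _ _) (norm_nonneg _)
          ((norm_nonneg _).trans this)) (by positivity) ((abs_nonneg _).trans (hE p.1))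
  have hkw1 : Integrable (fun p : T × T => ‖w p.1‖ ^ 2 * k p.1 p.2) (μ.prod μ) := by
    refine hk.bdd_mul (c := b ^ 2) ((hwm.norm.pow_const 2).comp measurable_fst).aestronglyMeasurable
      (Filter.Eventually.of_forall fun p => ?_)
    rw [Real.norm_of_nonneg (by positivity)]
    exact pow_le_pow_left₀ (norm_nonneg _) (hwb _) 2
  have hkw2 : Integrable (fun p : T × T => ‖w p.2‖ ^ 2 * k p.1 p.2) (μ.prod μ) := by
    refine hk.bdd_mul (c := b ^ 2) ((hwm.norm.pow_const 2).comp measurable_snd).aestronglyMeasurable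
      (Filter.Eventually.of_forall fun p => ?_)
    rw [Real.norm_of_nonneg (by positivity)]
    exact pow_le_pow_left₀ (norm_nonneg _) (hwb _) 2
  have hI1 : ∫ p, ‖w p.1‖ ^ 2 * k p.1 p.2 ∂(μ.prod μ) ≤ κ * A := by
    rw [integral_prod _ hkw1, hAw, ← integral_const_mul]
    refine integral_mono hkw1.integral_prod_left (hwsq.const_mul κ) fun t => ?_
    simp only [integral_const_mul]
    rw [mul_comm]
    exact mul_le_mul_of_nonneg_right (hk1 t) (by positivity)
  have hI2 : ∫ p, ‖w p.2‖ ^ 2 * k p.1 p.2 ∂(μ.prod μ) ≤ κ * A := by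
    rw [integral_prod_symm _ hkw2, hAw, ← integral_const_mul]
    refine integral_mono hkw2.integral_prod_right (hwsq.const_mul κ) fun t => ?_
    simp only [integral_const_mul]
    rw [mul_comm]
    exact mul_le_mul_of_nonneg_right (hk2 t) (by positivity)
  have hχW0 : 0 ≤ ∫ x, χ x * ‖W x‖ ^ 2 ∂ν :=
    integral_nonneg fun x => mul_nonneg (hχ0 x) (by positivity)
  have hχW : ∫ x, χ x * ‖W x‖ ^ 2 ∂ν ≤ κ * A := by
    have h1 : ‖((∫ x, χ x * ‖W x‖ ^ 2 ∂ν : ℝ) : ℂ)‖ ≤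
        ∫ p, (1 / 2) * (‖w p.1‖ ^ 2 * k p.1 p.2 + ‖w p.2‖ ^ 2 * k p.1 p.2) ∂(μ.prod μ) := by
      rw [hWW]
      refine norm_integral_le_of_norm_le ((hkw1.add hkw2).const_mul (1 / 2)) ?_
      filter_upwards [hkΦ] with p hp
      rw [norm_mul, norm_mul, RCLike.norm_conj (w p.2)]
      refine (mul_le_mul_of_nonneg_left hp (by positivity)).trans ?_
      have := hk0 p.1 p.2
      nlinarith [mul_nonneg (sq_nonneg (‖w p.1‖ - ‖w p.2‖)) this]
    rw [norm_real, Real.norm_of_nonneg hχW0, integral_const_mul, integral_add hkw1 hkw2] at h1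
    linarith
  have hχWi : Integrable (fun x => χ x * ‖W x‖ ^ 2) ν := by
    refine Integrable.of_bound (C := E * (b * B * μ.real Set.univ) ^ 2)
      (hχ.mul (hWm.norm.pow_const 2)).aestronglyMeasurable (Filter.Eventually.of_forall fun x => ?_)
    rw [norm_mul, norm_pow, norm_norm]
    exact mul_le_mul (hE x) (pow_le_pow_left₀ (norm_nonneg _) (hWb x) 2) (by positivity)
      ((abs_nonneg _).trans (hE x))
  have hgi : Integrable (fun x => ‖g x‖ ^ 2) ν := by
    refine Integrable.of_bound (C := D ^ 2) (hg.norm.pow_const 2).aestronglyMeasurable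
      (Filter.Eventually.of_forall fun x => ?_)
    rw [norm_pow, norm_norm]
    exact pow_le_pow_left₀ (norm_nonneg _) (hD x) 2
  have hfin : A ≤ κ / 2 * G + 1 / (2 * κ) * ∫ x, χ x * ‖W x‖ ^ 2 ∂ν := by
    have h1 : ‖(A : ℂ)‖ ≤ ∫ x, (κ / 2 * ‖g x‖ ^ 2 + 1 / (2 * κ) * (χ x * ‖W x‖ ^ 2)) ∂ν := by
      rw [hAW]
      refine norm_integral_le_of_norm_le ((hgi.const_mul _).add (hχWi.const_mul _))
        (Filter.Eventually.of_forall fun x => ?_)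
      rw [norm_mul]
      by_cases hx : g x = 0
      · have := hχ0 x
        simp only [hx, norm_zero, zero_mul]
        positivity
      · have h2 := hgχ x hx
        have h3 : ‖g x‖ * ‖W x‖ ≤ κ / 2 * ‖g x‖ ^ 2 + 1 / (2 * κ) * ‖W x‖ ^ 2 := by
          have : κ / 2 * ‖g x‖ ^ 2 + 1 / (2 * κ) * ‖W x‖ ^ 2 - ‖g x‖ * ‖W x‖
              = (κ * ‖g x‖ - ‖W x‖) ^ 2 / (2 * κ) := by
            field_simp
            ring
          have h4 : 0 ≤ (κ * ‖g x‖ - ‖W x‖) ^ 2 / (2 * κ) := by positivity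
          linarith
        refine h3.trans ?_
        gcongr
        nlinarith [sq_nonneg ‖W x‖]
    rw [norm_real, Real.norm_of_nonneg hA0, integral_add (hgi.const_mul _) (hχWi.const_mul _),
      integral_const_mul, integral_const_mul] at h1
    exact h1
  have h2 : 1 / (2 * κ) * ∫ x, χ x * ‖W x‖ ^ 2 ∂ν ≤ A / 2 := by
    calc 1 / (2 * κ) * ∫ x, χ x * ‖W x‖ ^ 2 ∂ν ≤ 1 / (2 * κ) * (κ * A) := by gcongr
      _ = A / 2 := by field_simp
  linarith

/-- A continuous family admits measurable near-maximizers over finite parameter sets. -/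
theorem exists_measurable_argmax {F : ℝ → ℝ → ℂ} (hF : Continuous (Function.uncurry F))
    (S : Finset ℝ) (hS : S.Nonempty) :
    ∃ ρ : ℝ → ℝ, Measurable ρ ∧ (∀ t, ρ t ∈ S) ∧ ∀ t, ∀ r ∈ S, ‖F t r‖ ≤ ‖F t (ρ t)‖ := by
  induction hS using Finset.Nonempty.cons_induction with
  | singleton r => exact ⟨fun _ => r, measurable_const, by simp, by simp⟩
  | cons r S h hS ih =>
    obtain ⟨ρ, hρ, hρS, hmax⟩ := ih
    have hm : MeasurableSet {t | ‖F t r‖ ≤ ‖F t (ρ t)‖} :=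
      measurableSet_le
        ((hF.measurable.comp (measurable_id.prodMk measurable_const)).norm)
        ((hF.measurable.comp (measurable_id.prodMk hρ)).norm)
    classical
    refine ⟨fun t => if ‖F t r‖ ≤ ‖F t (ρ t)‖ then ρ t else r, hρ.ite hm measurable_const,
      fun t => ?_, fun t r' hr' => ?_⟩
    · dsimp only
      split_ifs
      · exact Finset.mem_cons_of_mem (hρS t)
      · exact Finset.mem_cons_self _ _
    · dsimp only
      rcases Finset.mem_cons.1 hr' with rfl | hr'
      · split_ifs with h1
        · exact h1
        · exact le_rfl
      · split_ifs with h1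
        · exact hmax t r' hr'
        · exact (hmax t r' hr').trans (not_le.1 h1).le

/-- A radial wave with frequencies in `[1, 2]`, up to normalization. -/
def localizedWave (a : ℝ) (g : ℝ → ℂ) (t r : ℝ) : ℂ :=
  ∫ x in (1 : ℝ)..2, Complex.exp (I * (-t * x ^ a : ℝ)) * (g x * circleBessel (x * r))

theorem continuous_localizedWave {a : ℝ} (ha : 0 < a) {g : ℝ → ℂ} (hg : Continuous g) :
    Continuous (Function.uncurry (localizedWave a g)) := by
  have hrp : Continuous fun x : ℝ => x ^ a := continuous_id.rpow_const fun x => Or.inr ha.le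
  have hJ := continuous_circleBessel
  refine intervalIntegral.continuous_parametric_intervalIntegral_of_continuous'
    (f := fun (p : ℝ × ℝ) (x : ℝ) =>
      Complex.exp (I * (-p.1 * x ^ a : ℝ)) * (g x * circleBessel (x * p.2))) ?_ 1 2
  have h1 : Continuous fun q : (ℝ × ℝ) × ℝ => q.2 ^ a := hrp.comp continuous_snd
  have h2 : Continuous fun q : (ℝ × ℝ) × ℝ => g q.2 := hg.comp continuous_snd
  simp only [Function.uncurry_def]
  fun_prop

theorem exists_smooth_cutoff : ∃ χ : ℝ → ℝ, ContDiff ℝ (⊤ : ℕ∞) (fun x => (χ x : ℂ)) ∧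
    tsupport (fun x => (χ x : ℂ)) ⊆ Set.Ioo (1 / 2 : ℝ) 4 ∧ (∀ x, χ x ∈ Set.Icc (0 : ℝ) 1) ∧
      ∀ x ∈ Set.Icc (1 : ℝ) 2, χ x = 1 := by
  let χ : ContDiffBump (3 / 2 : ℝ) := ⟨1 / 2, 3 / 4, by norm_num, by norm_num⟩
  refine ⟨χ, Complex.ofRealCLM.contDiff.comp χ.contDiff, ?_, fun x => ⟨χ.nonneg, χ.le_one⟩,
    fun x hx => χ.one_of_mem_closedBall ?_⟩
  · have h1 : tsupport (fun x => (χ x : ℂ)) ⊆ tsupport χ :=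
      closure_mono (Function.support_comp_subset ofReal_zero _)
    refine h1.trans ?_
    rw [χ.tsupport_eq, Real.closedBall_eq_Icc]
    exact Set.Icc_subset_Ioo (by norm_num [χ]) (by norm_num [χ])
  · rw [Real.closedBall_eq_Icc]
    constructor <;> norm_num [χ] <;> [exact hx.1; exact hx.2]

theorem measurable_decayMajorant : Measurable decayMajorant := by
  have h : ∀ {S : Set ℝ} (p : ℝ), MeasurableSet S → Measurable (S.indicator fun x : ℝ => x ^ p) :=
    fun p hS => (measurable_id.pow_const p).indicator hS
  have h1 := (h (-(1 / 2)) measurableSet_Ioc).add (h (-(13 / 12)) measurableSet_Ioi)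
    (f := (Set.Ioc (0 : ℝ) 1).indicator _) (g := (Set.Ioi (1 : ℝ)).indicator _)
  exact h1.add (h1.comp measurable_neg)

theorem integral_localizedWave_selection_le {a : ℝ} (ha : 0 < a) {χ : ℝ → ℝ}
    (hχ : Measurable χ) (hχ1 : ∀ x, χ x ∈ Set.Icc (0 : ℝ) 1)
    (hχ2 : ∀ x ∈ Set.Icc (1 : ℝ) 2, χ x = 1) {P : Set ℝ} {c : ℝ} (hc : 0 < c)
    (hP : ∀ τ r r' : ℝ, τ ≠ 0 → r ∈ P → r' ∈ P →
      ‖besselKernel a (fun x => (χ x : ℂ)) τ r r'‖ ≤ c * decayMajorant τ)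
    {g : ℝ → ℂ} (hg : Continuous g) {ρ : ℝ → ℝ} (hρ : Measurable ρ) (hρP : ∀ t, ρ t ∈ P) (M : ℝ) :
    ∫ t in Set.Icc (-M) M, ‖localizedWave a g t (ρ t)‖ ^ 2 ≤
      c * (1 + ∫ τ, decayMajorant τ) * ∫ x in (1 : ℝ)..2, ‖g x‖ ^ 2 := by
  have hrp : Continuous fun x : ℝ => x ^ a := continuous_id.rpow_const fun x => Or.inr ha.le
  obtain ⟨D, hD⟩ := isCompact_Icc.exists_bound_of_continuousOn (s := Set.Icc (1 : ℝ) 2)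
    hg.continuousOn
  have hsub : Set.Ioc (1 : ℝ) 2 ⊆ Set.Ioc (1 / 2 : ℝ) 4 :=
    Set.Ioc_subset_Ioc (by norm_num) (by norm_num)
  set μ : Measure ℝ := volume.restrict (Set.Icc (-M) M) with hμ
  set ν : Measure ℝ := volume.restrict (Set.Ioc (1 / 2 : ℝ) 4) with hν
  have : IsFiniteMeasure μ := ⟨by simp [hμ]⟩
  have : IsFiniteMeasure ν := ⟨by simp [hν]⟩
  have hm0 : 0 ≤ ∫ τ, decayMajorant τ := integral_nonneg decayMajorant_nonneg
  have hki : ∀ t, Integrable (fun t' => c * decayMajorant (t - t')) := fun t =>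
    (integrable_decayMajorant.comp_sub_left t).const_mul c
  have hki' : ∀ t', Integrable (fun t => c * decayMajorant (t - t')) := fun t' =>
    (integrable_decayMajorant.comp_sub_right t').const_mul c
  have hk0 : ∀ t t', 0 ≤ c * decayMajorant (t - t') := fun t t' =>
    mul_nonneg hc.le (decayMajorant_nonneg _)
  have hk1 : ∀ t, ∫ t', c * decayMajorant (t - t') ∂μ ≤ c * (1 + ∫ τ, decayMajorant τ) := by
    intro t
    refine (setIntegral_le_integral (hki t) (Filter.Eventually.of_forall (hk0 t))).trans ?_
    rw [integral_const_mul, integral_sub_left_eq_self decayMajorant volume t]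
    gcongr
    linarith
  have hk2 : ∀ t', ∫ t, c * decayMajorant (t - t') ∂μ ≤ c * (1 + ∫ τ, decayMajorant τ) := by
    intro t'
    refine (setIntegral_le_integral (hki' t')
      (Filter.Eventually.of_forall fun t => hk0 t t')).trans ?_
    rw [integral_const_mul, integral_sub_right_eq_self decayMajorant t']
    gcongr
    linarith
  have key := integral_norm_sq_le_of_kernel_bound μ ν
    (Φ := fun t x => Complex.exp (I * (-t * x ^ a : ℝ)) * circleBessel (x * ρ t))
    (g := (Set.Ioc (1 : ℝ) 2).indicator g) (χ := χ) (B := 2 * Real.pi) (D := D) (E := 1)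
    (k := fun t t' => c * decayMajorant (t - t')) (κ := c * (1 + ∫ τ, decayMajorant τ))
    ?_ ?_ (hg.measurable.indicator measurableSet_Ioc) ?_ hχ ?_ (fun x => (hχ1 x).1) ?_ hk0 ?_ ?_
    (by positivity) hk1 hk2
  · have e1 : ∀ t, ∫ x, (Set.Ioc (1 : ℝ) 2).indicator g x *
        (Complex.exp (I * (-t * x ^ a : ℝ)) * circleBessel (x * ρ t)) ∂ν
          = localizedWave a g t (ρ t) := by
      intro t
      rw [localizedWave, intervalIntegral.integral_of_le (by norm_num),
        ← Set.inter_eq_right.2 hsub, ← setIntegral_indicator measurableSet_Ioc,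
        Set.inter_eq_right.2 hsub]
      refine integral_congr_ae (Filter.Eventually.of_forall fun x => ?_)
      by_cases hx : x ∈ Set.Ioc (1 : ℝ) 2
      · simp only [Set.indicator_of_mem hx]
        ring
      · simp only [Set.indicator_of_notMem hx, zero_mul]
    have e2 : ∫ x, ‖(Set.Ioc (1 : ℝ) 2).indicator g x‖ ^ 2 ∂ν = ∫ x in (1 : ℝ)..2, ‖g x‖ ^ 2 := by
      rw [intervalIntegral.integral_of_le (by norm_num),
        ← Set.inter_eq_right.2 hsub, ← setIntegral_indicator measurableSet_Ioc,
        Set.inter_eq_right.2 hsub]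
      refine integral_congr_ae (Filter.Eventually.of_forall fun x => ?_)
      by_cases hx : x ∈ Set.Ioc (1 : ℝ) 2
      · simp only [Set.indicator_of_mem hx]
      · simp [Set.indicator_of_notMem hx]
    simp only [e1] at key
    rwa [e2] at key
  · have h1 : Measurable fun p : ℝ × ℝ => p.2 ^ a := hrp.measurable.comp measurable_snd
    have h2 : Measurable fun p : ℝ × ℝ => circleBessel (p.2 * ρ p.1) :=
      continuous_circleBessel.measurable.comp (measurable_snd.mul (hρ.comp measurable_fst))
    simp only [Function.uncurry_def]
    fun_prop
  · intro t x
    rw [norm_mul, norm_cexp_I_mul_ofReal, one_mul, norm_real]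
    exact abs_circleBessel_le _
  · intro x
    by_cases hx : x ∈ Set.Ioc (1 : ℝ) 2
    · rw [Set.indicator_of_mem hx]
      exact hD x (Set.Ioc_subset_Icc_self hx)
    · rw [Set.indicator_of_notMem hx, norm_zero]
      exact (norm_nonneg _).trans (hD 1 (by norm_num))
  · intro x
    rw [abs_of_nonneg (hχ1 x).1]
    exact (hχ1 x).2
  · intro x hx
    have : x ∈ Set.Ioc (1 : ℝ) 2 := by
      by_contra h
      exact hx (Set.indicator_of_notMem h _)
    exact (hχ2 x (Set.Ioc_subset_Icc_self this)).ge
  · have hmeas : Measurable fun p : ℝ × ℝ => c * decayMajorant (p.1 - p.2) :=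
      (measurable_decayMajorant.comp (measurable_fst.sub measurable_snd)).const_mul c
    simp only [Function.uncurry_def]
    rw [integrable_prod_iff hmeas.aestronglyMeasurable]
    refine ⟨Filter.Eventually.of_forall fun t => (hki t).restrict, ?_⟩
    refine Integrable.of_bound (C := c * (1 + ∫ τ, decayMajorant τ))
      hmeas.stronglyMeasurable.norm.integral_prod_right'.aestronglyMeasurable
      (Filter.Eventually.of_forall fun t => ?_)
    simp only [Real.norm_of_nonneg (hk0 _ _)]
    rw [Real.norm_of_nonneg (integral_nonneg (hk0 t))]
    exact hk1 t
  · have hne : ∀ᵐ p ∂(μ.prod μ), p.1 - p.2 ≠ 0 := by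
      rw [Measure.ae_prod_iff_ae_ae]
      · refine Filter.Eventually.of_forall fun t => ?_
        have : ∀ᵐ t' ∂μ, t' ≠ t := ae_restrict_of_ae (Measure.ae_ne volume t)
        filter_upwards [this] with t' ht'
        exact sub_ne_zero.2 ht'.symm
      · exact ((measurableSet_singleton (0 : ℝ)).compl).preimage
          (measurable_fst.sub measurable_snd)
    filter_upwards [hne] with p hp
    refine le_trans (le_of_eq ?_) (hP _ (ρ p.1) (ρ p.2) hp (hρP _) (hρP _))
    rw [besselKernel, intervalIntegral.integral_of_le (by norm_num)]
    congr 1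
    refine integral_congr_ae (Filter.Eventually.of_forall fun x => ?_)
    have e : (starRingEnd ℂ) (Complex.exp (I * (-p.2 * x ^ a : ℝ)))
        = Complex.exp (I * (p.2 * x ^ a : ℝ)) := by
      rw [← Complex.exp_conj]
      congr 1
      simp
    have e' : Complex.exp (I * (-(p.1 - p.2) * x ^ a : ℝ)) =
        Complex.exp (I * (-p.1 * x ^ a : ℝ)) * Complex.exp (I * (p.2 * x ^ a : ℝ)) := by
      rw [← Complex.exp_add]
      congr 1
      push_cast
      ring
    simp only [map_mul, e, e', Complex.conj_ofReal]
    ring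

theorem norm_localizedWave_le {a : ℝ} {g : ℝ → ℂ} (hg : Continuous g) (t r : ℝ) :
    ‖localizedWave a g t r‖ ≤ 2 * Real.pi * ∫ x in (1 : ℝ)..2, ‖g x‖ := by
  rw [localizedWave, ← intervalIntegral.integral_const_mul]
  refine intervalIntegral.norm_integral_le_of_norm_le (by norm_num)
    (Filter.Eventually.of_forall fun x _ => ?_)
    ((continuous_const.mul hg.norm).intervalIntegrable _ _)
  rw [norm_mul, norm_cexp_I_mul_ofReal, one_mul, norm_mul, norm_real, mul_comm]
  exact mul_le_mul_of_nonneg_right (abs_circleBessel_le _) (norm_nonneg _)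

theorem measurable_iSup_enorm_sq {F : ℝ → ℝ → ℂ} (hF : Continuous (Function.uncurry F))
    (P : Set ℝ) : Measurable fun t => ⨆ r : P, ‖F t r‖ₑ ^ 2 := by
  refine LowerSemicontinuous.measurable (lowerSemicontinuous_iSup fun r => ?_)
  have : Continuous fun t => F t r := hF.comp (continuous_id.prodMk continuous_const)
  exact ((ENNReal.continuous_pow 2).comp this.enorm).lowerSemicontinuous

/-- A bound for all measurable selections of positions controls the maximal function. -/
theorem lintegral_iSup_enorm_sq_le {F : ℝ → ℝ → ℂ} (hF : Continuous (Function.uncurry F))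
    {B : ℝ} (hB : ∀ t r, ‖F t r‖ ≤ B) {P : Set ℝ} {A : ℝ}
    (hA : ∀ ρ : ℝ → ℝ, Measurable ρ → (∀ t, ρ t ∈ P) → ∀ M : ℝ,
      ∫ t in Set.Icc (-M) M, ‖F t (ρ t)‖ ^ 2 ≤ A) :
    ∫⁻ t, ⨆ r : P, ‖F t r‖ₑ ^ 2 ≤ ENNReal.ofReal A := by
  rcases P.eq_empty_or_nonempty with rfl | hP
  · simp
  have : Nonempty P := hP.to_subtype
  set u : ℕ → P := TopologicalSpace.denseSeq P with hu
  set h : ℕ → ℝ → ℝ≥0∞ := fun n t => ‖F t (u n)‖ₑ ^ 2 with hh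
  have hcont : ∀ r : ℝ, Continuous fun t => F t r := fun r =>
    hF.comp (continuous_id.prodMk continuous_const)
  have hcont' : ∀ t : ℝ, Continuous fun r : P => ‖F t r‖ₑ ^ 2 := fun t =>
    (ENNReal.continuous_pow 2).comp
      (hF.comp (continuous_const.prodMk continuous_subtype_val)).enorm
  have hhm : ∀ n, Measurable (h n) := fun n => (hcont (u n)).measurable.enorm.pow_const 2
  set G : ℕ → ℝ → ℝ≥0∞ := fun N =>
    (Set.Icc (-(N : ℝ)) N).indicator fun t => ⨆ n, ⨆ (_ : n ≤ N), h n t with hG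
  have hGm : ∀ N, Measurable (G N) := fun N =>
    (Measurable.iSup fun n => Measurable.iSup fun _ => hhm n).indicator measurableSet_Icc
  have hGmono : Monotone G := by
    intro N N' hN t
    have hsub : Set.Icc (-(N : ℝ)) N ⊆ Set.Icc (-(N' : ℝ)) N' := by
      have : (N : ℝ) ≤ N' := by exact_mod_cast hN
      exact Set.Icc_subset_Icc (by linarith) this
    refine (Set.indicator_le_indicator_of_subset hsub (fun _ => zero_le) t).trans ?_
    refine Set.indicator_le_indicator ?_
    exact iSup_mono fun n => iSup_mono' fun hn => ⟨hn.trans hN, le_rfl⟩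
  have hGA : ∀ N, ∫⁻ t, G N t ≤ ENNReal.ofReal A := by
    intro N
    obtain ⟨ρ, hρ, hρS, hmax⟩ := exists_measurable_argmax hF
      ((Finset.range (N + 1)).image fun n => (u n : ℝ)) (by simp)
    have hρP : ∀ t, ρ t ∈ P := fun t => by
      obtain ⟨n, _, hn⟩ := Finset.mem_image.1 (hρS t)
      rw [← hn]
      exact (u n).2
    have hm : Measurable fun t => F t (ρ t) := hF.measurable.comp (measurable_id.prodMk hρ)
    have hintg : Integrable (fun t => ‖F t (ρ t)‖ ^ 2)
        (volume.restrict (Set.Icc (-(N : ℝ)) N)) := by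
      have : IsFiniteMeasure (volume.restrict (Set.Icc (-(N : ℝ)) N)) := ⟨by simp⟩
      refine Integrable.of_bound (C := B ^ 2) (hm.norm.pow_const 2).aestronglyMeasurable
        (Filter.Eventually.of_forall fun t => ?_)
      rw [norm_pow, norm_norm]
      exact pow_le_pow_left₀ (norm_nonneg _) (hB _ _) 2
    rw [hG, lintegral_indicator measurableSet_Icc]
    calc ∫⁻ t in Set.Icc (-(N : ℝ)) N, ⨆ n, ⨆ (_ : n ≤ N), h n t
        ≤ ∫⁻ t in Set.Icc (-(N : ℝ)) N, ENNReal.ofReal (‖F t (ρ t)‖ ^ 2) := by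
          refine lintegral_mono fun t => iSup₂_le fun n hn => ?_
          rw [hh, ENNReal.ofReal_pow (norm_nonneg _), ofReal_norm]
          dsimp only
          gcongr
          rw [enorm_le_iff_norm_le]
          exact hmax t _ (Finset.mem_image_of_mem _ (Finset.mem_range.2 (by omega)))
      _ = ENNReal.ofReal (∫ t in Set.Icc (-(N : ℝ)) N, ‖F t (ρ t)‖ ^ 2) :=
          (ofReal_integral_eq_lintegral_ofReal hintg
            (Filter.Eventually.of_forall fun t => by positivity)).symm
      _ ≤ ENNReal.ofReal A := ENNReal.ofReal_le_ofReal (hA ρ hρ hρP N)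
  calc ∫⁻ t, ⨆ r : P, ‖F t r‖ₑ ^ 2 ≤ ∫⁻ t, ⨆ N, G N t := by
        refine lintegral_mono fun t => iSup_le fun r => ?_
        refine (TopologicalSpace.denseRange_denseSeq P).induction_on r
          (isClosed_le (hcont' t) continuous_const) fun n => ?_
        obtain ⟨m, hm⟩ := exists_nat_ge |t|
        refine le_trans ?_ (le_iSup (fun N => G N t) (max n m))
        have ht : t ∈ Set.Icc (-((max n m : ℕ) : ℝ)) ((max n m : ℕ) : ℝ) := by
          rw [Set.mem_Icc, ← abs_le]
          refine hm.trans ?_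
          exact_mod_cast le_max_right n m
        rw [hG]
        dsimp only
        rw [Set.indicator_of_mem ht]
        exact le_iSup₂_of_le (f := fun k (_ : k ≤ max n m) => h k t) n (le_max_left n m) le_rfl
    _ = ⨆ N, ∫⁻ t, G N t := lintegral_iSup hGm hGmono
    _ ≤ ENNReal.ofReal A := iSup_le hGA

/-- The unit-frequency endpoint maximal estimate. -/
theorem lintegral_iSup_localizedWave_le {a : ℝ} (ha : 1 < a) (ha2 : a < 2) :
    ∃ C : ℝ, 0 < C ∧ ∀ g : ℝ → ℂ, Continuous g →
      ∫⁻ t, ⨆ r : Set.Ici (0 : ℝ), ‖localizedWave a g t r‖ₑ ^ 2 ≤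
        ENNReal.ofReal (C * ∫ x in (1 : ℝ)..2, ‖g x‖ ^ 2) := by
  have ha0 : 0 < a := by linarith
  obtain ⟨χ, hχs, hχt, hχ1, hχ2⟩ := exists_smooth_cutoff
  have hχm : Measurable χ := by
    have := Complex.measurable_re.comp hχs.continuous.measurable
    simpa [Function.comp_def] using this
  obtain ⟨c, hc, hK0, hK⟩ := norm_besselKernel_le ha ha2 hχs hχt
  set m : ℝ := 1 + ∫ τ, decayMajorant τ with hm
  have hm0 : 0 < m := by
    have : 0 ≤ ∫ τ, decayMajorant τ := integral_nonneg decayMajorant_nonneg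
    positivity
  set θ : ℝ := (2 : ℝ) ^ (-(1 / 6) : ℝ) with hθ
  have hθ0 : 0 < θ := by positivity
  have hθ1 : θ < 1 := Real.rpow_lt_one_of_one_lt_of_neg (by norm_num) (by norm_num)
  have hsum : Summable fun j : ℕ => θ ^ j := summable_geometric_of_lt_one hθ0.le hθ1
  have hts : 0 ≤ ∑' j : ℕ, θ ^ j := tsum_nonneg fun j => by positivity
  refine ⟨c * m + c * m * ∑' j : ℕ, θ ^ j, by positivity, fun g hg => ?_⟩
  have hF := continuous_localizedWave ha0 hg
  set F := localizedWave a g with hFdef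
  set A : ℝ := ∫ x in (1 : ℝ)..2, ‖g x‖ ^ 2 with hA
  have hA0 : 0 ≤ A := intervalIntegral.integral_nonneg (by norm_num) fun x _ => by positivity
  have hB : ∀ t r, ‖F t r‖ ≤ 2 * Real.pi * ∫ x in (1 : ℝ)..2, ‖g x‖ := norm_localizedWave_le hg
  set P : ℕ → Set ℝ := fun j => Set.Icc (2 ^ j) (2 * 2 ^ j) with hP
  have b0 : ∫⁻ t, ⨆ r : Set.Icc (0 : ℝ) 1, ‖F t r‖ₑ ^ 2 ≤ ENNReal.ofReal (c * m * A) :=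
    lintegral_iSup_enorm_sq_le hF hB fun ρ hρ hρP M =>
      integral_localizedWave_selection_le ha0 hχm hχ1 hχ2 hc hK0 hg hρ hρP M
  have bj : ∀ j, ∫⁻ t, ⨆ r : P j, ‖F t r‖ₑ ^ 2 ≤ ENNReal.ofReal (c * m * θ ^ j * A) := by
    intro j
    have e : ((2 : ℝ) ^ j) ^ (-(1 / 6) : ℝ) = θ ^ j := by
      rw [hθ, ← Real.rpow_natCast, ← Real.rpow_natCast, ← Real.rpow_mul (by norm_num),
        ← Real.rpow_mul (by norm_num), mul_comm]
    have := lintegral_iSup_enorm_sq_le hF hB fun ρ hρ hρP M =>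
      integral_localizedWave_selection_le (P := P j) (c := c * θ ^ j) ha0 hχm hχ1 hχ2
        (by positivity) (fun τ r r' hτ hr hr' => by
          rw [← e]
          exact hK _ τ r r' (one_le_pow₀ (by norm_num)) hτ hr hr') hg hρ hρP M
    refine this.trans (le_of_eq ?_)
    rw [← hm, ← hA]
    ring_nf
  calc ∫⁻ t, ⨆ r : Set.Ici (0 : ℝ), ‖F t r‖ₑ ^ 2
      ≤ ∫⁻ t, ((⨆ r : Set.Icc (0 : ℝ) 1, ‖F t r‖ₑ ^ 2) + ∑' j, ⨆ r : P j, ‖F t r‖ₑ ^ 2) := by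
        refine lintegral_mono fun t => iSup_le fun r => ?_
        rcases le_or_gt (r : ℝ) 1 with h | h
        · exact le_add_right (le_iSup (fun x : Set.Icc (0 : ℝ) 1 => ‖F t x‖ₑ ^ 2) ⟨r, r.2, h⟩)
        · obtain ⟨j, hj1, hj2⟩ := exists_nat_pow_near h.le (one_lt_two : (1 : ℝ) < 2)
          refine le_add_left (le_trans ?_ (ENNReal.le_tsum j))
          exact le_iSup (fun x : P j => ‖F t x‖ₑ ^ 2) ⟨r, hj1, by rw [← pow_succ']; exact hj2.le⟩
    _ = (∫⁻ t, ⨆ r : Set.Icc (0 : ℝ) 1, ‖F t r‖ₑ ^ 2) + ∑' j, ∫⁻ t, ⨆ r : P j, ‖F t r‖ₑ ^ 2 := by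
        rw [lintegral_add_left (measurable_iSup_enorm_sq hF _),
          lintegral_tsum fun j => (measurable_iSup_enorm_sq hF _).aemeasurable]
    _ ≤ ENNReal.ofReal (c * m * A) + ∑' j : ℕ, ENNReal.ofReal (c * m * θ ^ j * A) :=
        add_le_add b0 (ENNReal.tsum_le_tsum bj)
    _ = ENNReal.ofReal ((c * m + c * m * ∑' j : ℕ, θ ^ j) * A) := by
        have e : ∀ j : ℕ, c * m * θ ^ j * A = c * m * A * θ ^ j := fun j => by ring
        simp only [e]
        rw [← ENNReal.ofReal_tsum_of_nonneg (fun j => by positivity) (hsum.mul_left _),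
          tsum_mul_left, ← ENNReal.ofReal_add (by positivity) (by positivity)]
        ring_nf

/-- A radial wave with frequencies in `[N, 2N]`, up to normalization. -/
def dyadicWave (a : ℝ) (G : ℝ → ℂ) (N t r : ℝ) : ℂ :=
  ∫ ρ in N..2 * N, Complex.exp (I * (-t * ρ ^ a : ℝ)) * (G ρ * circleBessel (ρ * r))

theorem dyadicWave_eq {a N : ℝ} (hN : 0 < N) (G : ℝ → ℂ) (t r : ℝ) :
    dyadicWave a G N t r =
      localizedWave a (fun x => (N : ℂ) * G (N * x)) (N ^ a * t) (N * r) := by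
  have h := intervalIntegral.integral_comp_mul_left (a := 1) (b := 2) (c := N)
    (fun ρ => Complex.exp (I * (-t * ρ ^ a : ℝ)) * (G ρ * circleBessel (ρ * r))) hN.ne'
  rw [mul_one, mul_comm N 2, eq_inv_smul_iff₀ hN.ne'] at h
  rw [dyadicWave, ← h, localizedWave, ← intervalIntegral.integral_smul]
  refine intervalIntegral.integral_congr fun x hx => ?_
  rw [Set.uIcc_of_le (by norm_num)] at hx
  have hx0 : 0 ≤ x := by linarith [hx.1]
  have e : -t * (N * x) ^ a = -(N ^ a * t) * x ^ a := by
    rw [Real.mul_rpow hN.le hx0]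
    ring
  simp only [e, Complex.real_smul]
  rw [show N * x * r = x * (N * r) by ring]
  ring

theorem integral_norm_sq_rescale {N : ℝ} (hN : 0 < N) (G : ℝ → ℂ) :
    ∫ x in (1 : ℝ)..2, ‖(N : ℂ) * G (N * x)‖ ^ 2 = N * ∫ ρ in N..2 * N, ‖G ρ‖ ^ 2 := by
  have h := intervalIntegral.integral_comp_mul_left (a := 1) (b := 2) (c := N)
    (fun ρ => ‖G ρ‖ ^ 2) hN.ne'
  rw [mul_one, mul_comm N 2, eq_inv_smul_iff₀ hN.ne'] at h
  rw [← h, smul_eq_mul, ← mul_assoc, ← intervalIntegral.integral_const_mul]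
  refine intervalIntegral.integral_congr fun x _ => ?_
  simp only [norm_mul, norm_real, Real.norm_of_nonneg hN.le]
  ring

theorem lintegral_comp_const_mul {c : ℝ} (hc : 0 < c) {f : ℝ → ℝ≥0∞} (hf : Measurable f) :
    ∫⁻ t, f (c * t) = ENNReal.ofReal c⁻¹ * ∫⁻ t, f t := by
  have h := Real.map_volume_mul_left hc.ne'
  rw [← lintegral_map hf (measurable_const_mul c), h, lintegral_smul_measure, smul_eq_mul,
    abs_of_pos (inv_pos.2 hc)]

theorem continuous_dyadicWave {a N : ℝ} (ha : 0 < a) (hN : 0 < N) {G : ℝ → ℂ}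
    (hG : Continuous G) : Continuous (Function.uncurry (dyadicWave a G N)) := by
  have hg : Continuous fun x => (N : ℂ) * G (N * x) := by fun_prop
  have h := (continuous_localizedWave ha hg).comp
    (by fun_prop : Continuous fun p : ℝ × ℝ => (N ^ a * p.1, N * p.2))
  refine h.congr fun p => ?_
  simp only [Function.comp_apply, Function.uncurry, dyadicWave_eq hN]

theorem lintegral_iSup_dyadicWave_sq_le {a : ℝ} (ha : 1 < a) (ha2 : a < 2) :
    ∃ C : ℝ, 0 < C ∧ ∀ N : ℝ, 0 < N → ∀ G : ℝ → ℂ, Continuous G →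
      ∫⁻ t, ⨆ r : Set.Ici (0 : ℝ), ‖dyadicWave a G N t r‖ₑ ^ 2 ≤
        ENNReal.ofReal (C * N ^ (1 - a) * ∫ ρ in N..2 * N, ‖G ρ‖ ^ 2) := by
  obtain ⟨C, hC, h⟩ := lintegral_iSup_localizedWave_le ha ha2
  refine ⟨C, hC, fun N hN G hG => ?_⟩
  have hg : Continuous fun x => (N : ℂ) * G (N * x) := by fun_prop
  have hNa : 0 < N ^ a := by positivity
  set S : ℝ → ℝ≥0∞ := fun t => ⨆ r : Set.Ici (0 : ℝ),
    ‖localizedWave a (fun x => (N : ℂ) * G (N * x)) t r‖ₑ ^ 2 with hS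
  have hSm : Measurable S :=
    measurable_iSup_enorm_sq (continuous_localizedWave (by linarith) hg) _
  calc ∫⁻ t, ⨆ r : Set.Ici (0 : ℝ), ‖dyadicWave a G N t r‖ₑ ^ 2
      ≤ ∫⁻ t, S (N ^ a * t) := by
        refine lintegral_mono fun t => iSup_le fun r => ?_
        rw [dyadicWave_eq hN]
        exact le_iSup (fun r : Set.Ici (0 : ℝ) =>
          ‖localizedWave a (fun x => (N : ℂ) * G (N * x)) (N ^ a * t) r‖ₑ ^ 2)
          ⟨N * r, mul_nonneg hN.le r.2⟩
    _ = ENNReal.ofReal (N ^ a)⁻¹ * ∫⁻ t, S t := lintegral_comp_const_mul hNa hSm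
    _ ≤ ENNReal.ofReal (N ^ a)⁻¹ * ENNReal.ofReal (C * (N * ∫ ρ in N..2 * N, ‖G ρ‖ ^ 2)) := by
        gcongr
        rw [← integral_norm_sq_rescale hN]
        exact h _ hg
    _ = ENNReal.ofReal (C * N ^ (1 - a) * ∫ ρ in N..2 * N, ‖G ρ‖ ^ 2) := by
        rw [← ENNReal.ofReal_mul (by positivity), Real.rpow_sub hN, Real.rpow_one]
        congr 1
        field_simp

theorem integral_norm_le_sqrt {N : ℝ} (hN : 0 < N) {G : ℝ → ℂ} (hG : Continuous G) :
    ∫ ρ in N..2 * N, ‖G ρ‖ ≤ √(N * ∫ ρ in N..2 * N, ‖G ρ‖ ^ 2) := by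
  set S : ℝ := ∫ ρ in N..2 * N, ‖G ρ‖ with hS
  set A : ℝ := ∫ ρ in N..2 * N, ‖G ρ‖ ^ 2 with hA
  have h0 : 0 ≤ ∫ ρ in N..2 * N, (‖G ρ‖ - S / N) ^ 2 :=
    intervalIntegral.integral_nonneg (by linarith) fun x _ => by positivity
  have h1 : ∫ ρ in N..2 * N, (‖G ρ‖ - S / N) ^ 2 = A - 2 * (S / N) * S + N * (S / N) ^ 2 := by
    have e : ∀ ρ, (‖G ρ‖ - S / N) ^ 2 = ‖G ρ‖ ^ 2 - 2 * (S / N) * ‖G ρ‖ + (S / N) ^ 2 := fun ρ => by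
      ring
    simp only [e]
    have i1 : IntervalIntegrable (fun ρ => ‖G ρ‖ ^ 2) volume N (2 * N) :=
      (by fun_prop : Continuous fun ρ => ‖G ρ‖ ^ 2).intervalIntegrable _ _
    have i2 : IntervalIntegrable (fun ρ => 2 * (S / N) * ‖G ρ‖) volume N (2 * N) :=
      (by fun_prop : Continuous fun ρ => 2 * (S / N) * ‖G ρ‖).intervalIntegrable _ _
    rw [intervalIntegral.integral_add (i1.sub i2) intervalIntegrable_const,
      intervalIntegral.integral_sub i1 i2, intervalIntegral.integral_const_mul,
      intervalIntegral.integral_const, smul_eq_mul]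
    ring
  refine Real.le_sqrt_of_sq_le ?_
  have h2 : A - 2 * (S / N) * S + N * (S / N) ^ 2 = A - S ^ 2 / N := by
    field_simp
    ring
  rw [h1, h2, sub_nonneg, div_le_iff₀ hN] at h0
  linarith

theorem norm_dyadicWave_le {a N : ℝ} (hN : 0 < N) {G : ℝ → ℂ} (hG : Continuous G) (t r : ℝ) :
    ‖dyadicWave a G N t r‖ ≤ 2 * Real.pi * √(N * ∫ ρ in N..2 * N, ‖G ρ‖ ^ 2) := by
  refine le_trans ?_ (mul_le_mul_of_nonneg_left (integral_norm_le_sqrt hN hG) Real.two_pi_pos.le)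
  rw [dyadicWave, ← intervalIntegral.integral_const_mul]
  refine intervalIntegral.norm_integral_le_of_norm_le (by linarith)
    (Filter.Eventually.of_forall fun x _ => ?_)
    ((continuous_const.mul hG.norm).intervalIntegrable _ _)
  rw [norm_mul, norm_cexp_I_mul_ofReal, one_mul, norm_mul, norm_real, mul_comm]
  exact mul_le_mul_of_nonneg_right (abs_circleBessel_le _) (norm_nonneg _)

/-- The maximal function of a dyadic radial wave. -/
def dyadicMax (a : ℝ) (G : ℝ → ℂ) (N t : ℝ) : ℝ≥0∞ :=
  ⨆ r : Set.Ici (0 : ℝ), ‖dyadicWave a G N t r‖ₑ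

theorem measurable_dyadicMax {a N : ℝ} (ha : 0 < a) (hN : 0 < N) {G : ℝ → ℂ}
    (hG : Continuous G) : Measurable (dyadicMax a G N) := by
  refine LowerSemicontinuous.measurable (lowerSemicontinuous_iSup fun r => ?_)
  have : Continuous fun t => dyadicWave a G N t r :=
    (continuous_dyadicWave ha hN hG).comp (continuous_id.prodMk continuous_const)
  exact this.enorm.lowerSemicontinuous

/-- The dyadic maximal estimate in `L^q`. -/
theorem lintegral_dyadicMax_rpow_le {a : ℝ} (ha : 1 < a) (ha2 : a < 2) {q : ℝ} (hq : 2 ≤ q) :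
    ∃ C : ℝ, 0 < C ∧ ∀ N : ℝ, 0 < N → ∀ G : ℝ → ℂ, Continuous G →
      (∫⁻ t, dyadicMax a G N t ^ q) ^ (1 / q) ≤
        ENNReal.ofReal (C * N ^ (1 / 2 - a / q) * √(∫ ρ in N..2 * N, ‖G ρ‖ ^ 2)) := by
  obtain ⟨C, hC, h⟩ := lintegral_iSup_dyadicWave_sq_le ha ha2
  have hq0 : 0 < q := by linarith
  have hpi := Real.two_pi_pos
  refine ⟨(2 * Real.pi) ^ ((q - 2) / q) * C ^ (1 / q), by positivity, fun N hN G hG => ?_⟩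
  set A : ℝ := ∫ ρ in N..2 * N, ‖G ρ‖ ^ 2 with hA
  have hA0 : 0 ≤ A := intervalIntegral.integral_nonneg (by linarith) fun x _ => by positivity
  set b : ℝ := 2 * Real.pi * √(N * A) with hb
  have hb0 : 0 ≤ b := by positivity
  have hle : ∀ t, dyadicMax a G N t ≤ ENNReal.ofReal b := fun t => iSup_le fun r => by
    rw [← ofReal_norm]
    exact ENNReal.ofReal_le_ofReal (norm_dyadicWave_le hN hG t r)
  have hintg : ∫⁻ t, dyadicMax a G N t ^ q ≤
      ENNReal.ofReal (b ^ (q - 2) * (C * N ^ (1 - a) * A)) := by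
    calc ∫⁻ t, dyadicMax a G N t ^ q
        ≤ ∫⁻ t, ENNReal.ofReal (b ^ (q - 2)) *
            ⨆ r : Set.Ici (0 : ℝ), ‖dyadicWave a G N t r‖ₑ ^ 2 := by
          refine lintegral_mono fun t => ?_
          rw [← ENNReal.iSup_pow, ← ENNReal.ofReal_rpow_of_nonneg hb0 (by linarith)]
          have e : dyadicMax a G N t ^ q
              = dyadicMax a G N t ^ (q - 2) * dyadicMax a G N t ^ 2 := by
            rw [← ENNReal.rpow_two, ← ENNReal.rpow_add_of_nonneg _ _ (by linarith) (by norm_num)]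
            congr 1
            ring
          rw [e]
          have := hle t
          change dyadicMax a G N t ^ (q - 2) * dyadicMax a G N t ^ 2 ≤
            ENNReal.ofReal b ^ (q - 2) * dyadicMax a G N t ^ 2
          gcongr
      _ = ENNReal.ofReal (b ^ (q - 2)) *
            ∫⁻ t, ⨆ r : Set.Ici (0 : ℝ), ‖dyadicWave a G N t r‖ₑ ^ 2 :=
          lintegral_const_mul' _ _ ENNReal.ofReal_ne_top
      _ ≤ ENNReal.ofReal (b ^ (q - 2)) * ENNReal.ofReal (C * N ^ (1 - a) * A) := by
          gcongr
          exact h N hN G hG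
      _ = _ := (ENNReal.ofReal_mul (by positivity)).symm
  refine (ENNReal.rpow_le_rpow hintg (by positivity)).trans ?_
  rw [ENNReal.ofReal_rpow_of_nonneg (by positivity) (by positivity)]
  refine ENNReal.ofReal_le_ofReal (le_of_eq ?_)
  rcases hA0.eq_or_lt with h0 | hA1
  · rw [← h0]
    simp [hq0.ne']
  · have hNA : 0 < N * A := by positivity
    rw [hb]
    generalize 2 * Real.pi = p at hpi ⊢
    rw [Real.sqrt_eq_rpow, Real.sqrt_eq_rpow, Real.mul_rpow hN.le hA0,
      Real.mul_rpow (by positivity) (by positivity), Real.mul_rpow (by positivity) (by positivity),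
      Real.mul_rpow (by positivity) (by positivity), Real.mul_rpow (by positivity) (by positivity),
      Real.mul_rpow (by positivity) (by positivity), Real.mul_rpow (by positivity) (by positivity),
      Real.mul_rpow (by positivity) (by positivity)]
    simp only [← Real.rpow_mul hN.le, ← Real.rpow_mul hA0, ← Real.rpow_mul hpi.le]
    have e1 : N ^ (1 / 2 - a / q) = N ^ (1 / 2 * (q - 2) * (1 / q)) * N ^ ((1 - a) * (1 / q)) := by
      rw [← Real.rpow_add hN]
      congr 1
      field_simp
      ring
    have e2 : A ^ (1 / 2 : ℝ) = A ^ (1 / 2 * (q - 2) * (1 / q)) * A ^ (1 / q) := by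
      rw [← Real.rpow_add hA1]
      congr 1
      field_simp
      ring
    rw [e1, e2, mul_one_div (q - 2) q]
    ring

theorem integral_inner_eq_of_norm_eq {d : ℕ} (F : ℝ → ℂ) {Φ : Ed d → ℂ}
    (hΦ : ∀ ξ η, ‖ξ‖ = ‖η‖ → Φ ξ = Φ η) {x y : Ed d} (hxy : ‖x‖ = ‖y‖) :
    ∫ ξ, F ⟪x, ξ⟫ * Φ ξ = ∫ ξ, F ⟪y, ξ⟫ * Φ ξ := by
  set T := (ℝ ∙ (x - y))ᗮ.reflection with hT
  have hTx : T x = y := Submodule.reflection_sub hxy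
  rw [← (T.measurePreserving).integral_comp T.toHomeomorph.measurableEmbedding
    (fun ξ => F ⟪y, ξ⟫ * Φ ξ)]
  refine integral_congr_ae (ae_of_all _ fun ξ => ?_)
  simp only
  rw [← hTx, T.inner_map_map, hΦ (T ξ) ξ (T.norm_map ξ)]

theorem integral_cexp_cos_sin (A B : ℝ) :
    ∫ θ in (0 : ℝ)..2 * Real.pi, Complex.exp (I * ((A * Real.cos θ + B * Real.sin θ : ℝ) : ℂ)) =
      circleBessel ‖(A + B * I : ℂ)‖ := by
  set z : ℂ := A + B * I with hz
  have hA : ‖z‖ * Real.cos z.arg = A := by rw [Complex.norm_mul_cos_arg]; simp [hz]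
  have hB : ‖z‖ * Real.sin z.arg = B := by rw [Complex.norm_mul_sin_arg]; simp [hz]
  set g : ℝ → ℂ := fun θ => Complex.exp (I * ((‖z‖ * Real.cos θ : ℝ) : ℂ)) with hg
  have hper : Function.Periodic g (2 * Real.pi) := fun θ => by
    simp only [hg, Real.cos_add_two_pi]
  have e : ∀ θ : ℝ, Complex.exp (I * ((A * Real.cos θ + B * Real.sin θ : ℝ) : ℂ)) =
      g (θ - z.arg) := fun θ => by
    simp only [hg]
    rw [Real.cos_sub, ← hA, ← hB]
    congr 3
    rw [hA, hB]
    linear_combination -Real.cos θ * hA - Real.sin θ * hB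
  simp_rw [e]
  rw [intervalIntegral.integral_comp_sub_right g, circleBessel_eq_integral_cexp]
  have h := hper.intervalIntegral_add_eq (0 - z.arg) 0
  rw [zero_add] at h
  rw [← h]
  congr 1
  ring

theorem integral_cexp_inner_eq {d : ℕ} {e₀ e₁ : Ed d} (h₀ : ‖e₀‖ = 1)
    (h₁ : ‖e₁‖ = 1) (h₀₁ : ⟪e₀, e₁⟫ = 0) {Φ : Ed d → ℂ}
    (hΦ : ∀ ξ η, ‖ξ‖ = ‖η‖ → Φ ξ = Φ η) (hintg : Integrable Φ) (x : Ed d) :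
    ∫ ξ, Complex.exp (I * ((⟪x, ξ⟫ : ℝ) : ℂ)) * Φ ξ =
      (2 * Real.pi : ℂ)⁻¹ *
        ∫ ξ, (circleBessel (‖x‖ * ‖(⟪e₀, ξ⟫ + ⟪e₁, ξ⟫ * I : ℂ)‖) : ℂ) * Φ ξ := by
  set r := ‖x‖ with hr
  have hr0 : 0 ≤ r := norm_nonneg x
  have hpi : (2 * Real.pi : ℂ) ≠ 0 := by
    exact_mod_cast Real.two_pi_pos.ne'
  set xθ : ℝ → Ed d :=
    fun θ => (r * Real.cos θ) • e₀ + (r * Real.sin θ) • e₁ with hxθ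
  have hnorm : ∀ θ, ‖x‖ = ‖xθ θ‖ := fun θ => by
    have h : ‖xθ θ‖ ^ 2 = r ^ 2 := by
      rw [hxθ]
      simp only
      rw [norm_add_sq_real, norm_smul, norm_smul, inner_smul_left, inner_smul_right, h₀₁, h₀, h₁]
      simp only [Real.norm_eq_abs, mul_one, sq_abs, mul_zero, add_zero]
      linear_combination r ^ 2 * Real.cos_sq_add_sin_sq θ
    exact ((pow_left_inj₀ (norm_nonneg _) hr0 two_ne_zero).1 h).symm
  have hinner : ∀ θ ξ, (⟪xθ θ, ξ⟫ : ℝ) =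
      (r * ⟪e₀, ξ⟫) * Real.cos θ + (r * ⟪e₁, ξ⟫) * Real.sin θ := fun θ ξ => by
    simp only [hxθ, inner_add_left, real_inner_smul_left]
    ring
  have hconst : ∀ θ : ℝ, ∫ ξ, Complex.exp (I * ((⟪x, ξ⟫ : ℝ) : ℂ)) * Φ ξ =
      ∫ ξ, Complex.exp (I * (((r * ⟪e₀, ξ⟫) * Real.cos θ +
        (r * ⟪e₁, ξ⟫) * Real.sin θ : ℝ) : ℂ)) * Φ ξ := fun θ => by
    rw [integral_inner_eq_of_norm_eq (fun v => Complex.exp (I * (v : ℂ))) hΦ (hnorm θ)]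
    simp_rw [hinner]
  have hswap : ∫ θ in (0 : ℝ)..2 * Real.pi,
        ∫ ξ, Complex.exp (I * (((r * ⟪e₀, ξ⟫) * Real.cos θ +
          (r * ⟪e₁, ξ⟫) * Real.sin θ : ℝ) : ℂ)) * Φ ξ =
      ∫ ξ, ∫ θ in (0 : ℝ)..2 * Real.pi, Complex.exp (I * (((r * ⟪e₀, ξ⟫) * Real.cos θ +
          (r * ⟪e₁, ξ⟫) * Real.sin θ : ℝ) : ℂ)) * Φ ξ := by
    rw [intervalIntegral.integral_of_le Real.two_pi_pos.le, integral_integral_swap]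
    · refine integral_congr_ae (ae_of_all _ fun ξ => ?_)
      simp only
      rw [intervalIntegral.integral_of_le Real.two_pi_pos.le]
    · have h1 : Integrable (fun p : ℝ × Ed d => Φ p.2)
          ((volume.restrict (Set.Ioc 0 (2 * Real.pi))).prod volume) := hintg.comp_snd _
      refine h1.bdd_mul (c := 1) ?_ (ae_of_all _ fun p => ?_)
      · refine Continuous.aestronglyMeasurable ?_
        fun_prop
      · exact (norm_cexp_I_mul_ofReal _).le
  have key : (2 * Real.pi : ℂ) * ∫ ξ, Complex.exp (I * ((⟪x, ξ⟫ : ℝ) : ℂ)) * Φ ξ =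
      ∫ ξ, (circleBessel (r * ‖(⟪e₀, ξ⟫ + ⟪e₁, ξ⟫ * I : ℂ)‖) : ℂ) * Φ ξ := by
    calc (2 * Real.pi : ℂ) * ∫ ξ, Complex.exp (I * ((⟪x, ξ⟫ : ℝ) : ℂ)) * Φ ξ
        = ∫ θ in (0 : ℝ)..2 * Real.pi, ∫ ξ, Complex.exp (I * ((⟪x, ξ⟫ : ℝ) : ℂ)) * Φ ξ := by
          rw [intervalIntegral.integral_const, Complex.real_smul]
          push_cast
          ring
      _ = _ := by
          rw [intervalIntegral.integral_congr fun θ _ => hconst θ, hswap]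
          refine integral_congr_ae (ae_of_all _ fun ξ => ?_)
          simp only
          rw [intervalIntegral.integral_mul_const, integral_cexp_cos_sin]
          congr 3
          rw [← Real.norm_of_nonneg hr0, ← Complex.norm_real, ← norm_mul]
          rw [Complex.norm_real, Real.norm_of_nonneg hr0]
          congr 1
          push_cast
          ring
  rw [← key, inv_mul_cancel_left₀ hpi]

theorem integral_eq_integral_sphere_integral_Ioi {E F : Type*} [NormedAddCommGroup E]
    [NormedSpace ℝ E] [FiniteDimensional ℝ E] [MeasurableSpace E] [BorelSpace E] [Nontrivial E]
    [NormedAddCommGroup F] [NormedSpace ℝ F] (μ : Measure E) [μ.IsAddHaarMeasure] {f : E → F}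
    (hf : Integrable f μ) :
    ∫ x, f x ∂μ = ∫ ω, ∫ ρ in Set.Ioi (0 : ℝ),
      ρ ^ (Module.finrank ℝ E - 1) • f (ρ • (ω : E)) ∂volume ∂μ.toSphere := by
  set n := Module.finrank ℝ E - 1
  set H := homeomorphUnitSphereProd E with hH
  set g : Metric.sphere (0 : E) 1 × Set.Ioi (0 : ℝ) → F := fun p => f ((p.2 : ℝ) • (p.1 : E))
    with hg
  have hgH : ∀ x, g (H x) = f x := fun x => by
    have h := congrArg Subtype.val (H.symm_apply_apply x)
    rw [homeomorphUnitSphereProd_symm_apply_coe] at h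
    simp only [hg, h]
  have hmp := μ.measurePreserving_homeomorphUnitSphereProd
  have hintg : Integrable g (μ.toSphere.prod (Measure.volumeIoiPow n)) := by
    rw [← hmp.integrable_comp_emb H.measurableEmbedding]
    have : g ∘ H = f ∘ Subtype.val := funext hgH
    rw [this, ← integrableOn_iff_comap_subtypeVal (measurableSet_singleton _).compl]
    exact hf.integrableOn
  calc ∫ x, f x ∂μ = ∫ x : ({(0)}ᶜ : Set E), f x ∂(μ.comap (↑)) := by
        rw [integral_subtype_comap (measurableSet_singleton _).compl f,
          restrict_compl_singleton]
    _ = ∫ p, g p ∂μ.toSphere.prod (Measure.volumeIoiPow n) := by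
        rw [← hmp.integral_comp H.measurableEmbedding]
        simp_rw [← hH, hgH]
    _ = _ := by
        rw [integral_prod _ hintg]
        refine integral_congr_ae (ae_of_all _ fun ω => ?_)
        simp only [hg, Measure.volumeIoiPow, ENNReal.ofReal]
        rw [integral_withDensity_eq_integral_smul
            (measurable_subtype_coe.pow_const _).real_toNNReal,
          integral_subtype_comap measurableSet_Ioi
            fun a : ℝ => Real.toNNReal (a ^ n) • f (a • (ω : E))]
        refine setIntegral_congr_fun measurableSet_Ioi fun x hx => ?_
        rw [NNReal.smul_def, Real.coe_toNNReal _ (pow_nonneg (le_of_lt hx) _)]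

theorem iUnion_Ioc_two_zpow : ⋃ k : ℤ, Set.Ioc ((2 : ℝ) ^ k) (2 * 2 ^ k) = Set.Ioi 0 := by
  ext x
  simp only [Set.mem_iUnion, Set.mem_Ioi]
  constructor
  · rintro ⟨k, hk⟩
    exact lt_trans (by positivity) hk.1
  · intro hx
    obtain ⟨k, hk⟩ := exists_mem_Ioc_zpow hx (one_lt_two : (1 : ℝ) < 2)
    exact ⟨k, by rwa [zpow_add_one₀ two_ne_zero, mul_comm] at hk⟩

theorem pairwise_disjoint_Ioc_two_zpow :
    Pairwise (Function.onFun Disjoint fun k : ℤ => Set.Ioc ((2 : ℝ) ^ k) (2 * 2 ^ k)) := by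
  intro j k hjk
  simp only [Function.onFun]
  rw [Set.disjoint_left]
  intro x hj hk
  have h1 : (2 : ℝ) ^ j < 2 ^ (k + 1) := by
    rw [zpow_add_one₀ two_ne_zero, mul_comm]; exact hj.1.trans_le hk.2
  have h2 : (2 : ℝ) ^ k < 2 ^ (j + 1) := by
    rw [zpow_add_one₀ two_ne_zero, mul_comm]; exact hk.1.trans_le hj.2
  rw [zpow_lt_zpow_iff_right₀ one_lt_two] at h1 h2
  omega

theorem enorm_integral_Ioi_le_tsum {h : ℝ → ℂ} (hh : IntegrableOn h (Set.Ioi 0)) :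
    ‖∫ ρ in Set.Ioi (0 : ℝ), h ρ‖ₑ ≤ ∑' k : ℤ, ‖∫ ρ in (2 : ℝ) ^ k..2 * 2 ^ k, h ρ‖ₑ := by
  have hs := hasSum_integral_iUnion (fun k : ℤ => (measurableSet_Ioc :
    MeasurableSet (Set.Ioc ((2 : ℝ) ^ k) (2 * 2 ^ k)))) pairwise_disjoint_Ioc_two_zpow
    (by rw [iUnion_Ioc_two_zpow]; exact hh)
  rw [iUnion_Ioc_two_zpow] at hs
  rw [← hs.tsum_eq]
  refine enorm_tsum_le_tsum_enorm.trans_eq (tsum_congr fun k => ?_)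
  rw [intervalIntegral.integral_of_le]
  have : (0 : ℝ) < 2 ^ k := by positivity
  linarith

theorem lintegral_tsum_rpow_le {α ι : Type*} [MeasurableSpace α] [Countable ι] {μ : Measure α}
    {f : ι → α → ℝ≥0∞} (hf : ∀ i, Measurable (f i)) {q : ℝ} (hq : 1 ≤ q) :
    (∫⁻ x, (∑' i, f i x) ^ q ∂μ) ^ (1 / q) ≤ ∑' i, (∫⁻ x, f i x ^ q ∂μ) ^ (1 / q) := by
  have hq0 : 0 < q := by linarith
  have hmap : ∀ {p : ℝ} (_ : 0 < p) (u : Finset ι → ℝ≥0∞), (⨆ s, u s) ^ p = ⨆ s, u s ^ p :=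
    fun hp u => (ENNReal.orderIsoRpow _ hp).map_iSup u
  simp_rw [ENNReal.tsum_eq_iSup_sum (f := fun i => f i _), hmap hq0]
  rw [lintegral_iSup_directed, hmap (by positivity)]
  · refine iSup_le fun s => ?_
    have h := eLpNorm'_sum_le (s := s) (μ := μ) (fun i _ => (hf i).aestronglyMeasurable) hq
    simp only [eLpNorm', enorm_eq_self, Finset.sum_apply] at h
    exact h.trans (ENNReal.sum_le_tsum s)
  · intro s
    exact ((Finset.measurable_sum s fun i _ => hf i).pow_const q).aemeasurable
  · refine Monotone.directed_le fun s t hst x => ?_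
    exact ENNReal.rpow_le_rpow (Finset.sum_le_sum_of_subset hst) hq0.le

theorem enorm_radialWave_le {d : ℕ} (hd : 2 ≤ d) (a : ℝ) {φ : ℝ → ℂ}
    (hintg : Integrable fun ξ : Ed d => φ ‖ξ‖) (t : ℝ)
    (x : Ed d) :
    ‖∫ ξ : Ed d, Complex.exp (I * ((⟪x, ξ⟫ : ℝ) : ℂ)) *
        (Complex.exp (I * (-t * ‖ξ‖ ^ a : ℝ)) * φ ‖ξ‖)‖ₑ ≤
      (volume : Measure (Ed d)).toSphere Set.univ *
        ∑' k : ℤ, dyadicMax a (fun ρ => (ρ : ℂ) ^ (d - 1) * φ ρ) (2 ^ k) t := by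
  have : NeZero d := ⟨by omega⟩
  have : Nontrivial (Fin d) := Fin.nontrivial_iff_two_le.2 hd
  set i₀ : Fin d := ⟨0, by omega⟩
  set i₁ : Fin d := ⟨1, by omega⟩
  have hi : i₀ ≠ i₁ := by simp [i₀, i₁]
  set e₀ : Ed d := EuclideanSpace.single i₀ 1 with he₀
  set e₁ : Ed d := EuclideanSpace.single i₁ 1 with he₁
  have h₀ : ‖e₀‖ = 1 := by simp [he₀]
  have h₁ : ‖e₁‖ = 1 := by simp [he₁]
  have h₀₁ : ⟪e₀, e₁⟫ = 0 := by simp [he₀, he₁, EuclideanSpace.inner_single_left, hi]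
  set Φ : Ed d → ℂ := fun ξ => Complex.exp (I * (-t * ‖ξ‖ ^ a : ℝ)) * φ ‖ξ‖ with hΦ
  have hmeas : Measurable fun ρ : ℝ => Complex.exp (I * (-t * ρ ^ a : ℝ)) := by fun_prop
  have hΦint : Integrable Φ :=
    hintg.bdd_mul (c := 1) (hmeas.comp measurable_norm).aestronglyMeasurable
      (ae_of_all _ fun ξ => (norm_cexp_I_mul_ofReal _).le)
  set σ : Ed d → ℝ := fun ξ => ‖(⟪e₀, ξ⟫ + ⟪e₁, ξ⟫ * I : ℂ)‖ with hσ
  have hσsmul : ∀ (ρ : ℝ) (ω : Ed d), 0 < ρ → σ (ρ • ω) = ρ * σ ω := fun ρ ω hρ => by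
    simp only [hσ, real_inner_smul_right]
    rw [← Real.norm_of_nonneg hρ.le, ← Complex.norm_real, ← norm_mul, Complex.norm_real,
      Real.norm_of_nonneg hρ.le]
    congr 1
    push_cast
    ring
  have hσc : Continuous σ := by fun_prop
  have hJint : Integrable fun ξ : Ed d => (circleBessel (‖x‖ * σ ξ) : ℂ) * Φ ξ := by
    refine hΦint.bdd_mul (c := 2 * Real.pi) ?_ (ae_of_all _ fun ξ => ?_)
    · have := continuous_circleBessel
      exact Continuous.aestronglyMeasurable (by fun_prop)
    · rw [Complex.norm_real]
      exact abs_circleBessel_le _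
  have hfin : Module.finrank ℝ (Ed d) = d := by simp
  have hIoi : IntegrableOn (fun ρ : ℝ => ρ ^ (d - 1) • φ ρ) (Set.Ioi 0) := by
    have h := (integrable_fun_norm_addHaar (volume : Measure (Ed d)) (f := φ)).1 hintg
    rwa [hfin] at h
  have hinner : ∀ ω : Metric.sphere (0 : Ed d) 1,
      ‖∫ ρ in Set.Ioi (0 : ℝ), ρ ^ (d - 1) •
        ((circleBessel (‖x‖ * σ (ρ • (ω : Ed d))) : ℂ) * Φ (ρ • (ω : Ed d)))‖ₑ ≤
        ∑' k : ℤ, dyadicMax a (fun ρ => (ρ : ℂ) ^ (d - 1) * φ ρ) (2 ^ k) t := fun ω => by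
    have hω : ‖(ω : Ed d)‖ = 1 := by simp
    set R := ‖x‖ * σ ω with hR
    have hR0 : 0 ≤ R := by positivity
    have e : ∫ ρ in Set.Ioi (0 : ℝ), ρ ^ (d - 1) •
        ((circleBessel (‖x‖ * σ (ρ • (ω : Ed d))) : ℂ) * Φ (ρ • (ω : Ed d))) =
        ∫ ρ in Set.Ioi (0 : ℝ), Complex.exp (I * (-t * ρ ^ a : ℝ)) *
          ((ρ : ℂ) ^ (d - 1) * φ ρ * circleBessel (ρ * R)) := by
      refine setIntegral_congr_fun measurableSet_Ioi fun ρ hρ => ?_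
      have hρ' : 0 < ρ := hρ
      simp only [hΦ, norm_smul, hω, mul_one, Real.norm_of_nonneg hρ'.le, hσsmul ρ ω hρ',
        Complex.real_smul, hR]
      rw [show ‖x‖ * (ρ * σ ω) = ρ * (‖x‖ * σ ω) by ring]
      push_cast
      ring
    rw [e]
    refine (enorm_integral_Ioi_le_tsum ?_).trans (ENNReal.tsum_le_tsum fun k => ?_)
    · have h1 : IntegrableOn (fun ρ : ℝ => (Complex.exp (I * (-t * ρ ^ a : ℝ)) *
          circleBessel (ρ * R)) * ρ ^ (d - 1) • φ ρ) (Set.Ioi 0) := by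
        refine hIoi.bdd_mul (c := 2 * Real.pi) ?_ (ae_of_all _ fun ρ => ?_)
        · have hc := continuous_circleBessel
          have hc' : Measurable fun ρ : ℝ => (circleBessel (ρ * R) : ℂ) :=
            Continuous.measurable (by fun_prop)
          exact (hmeas.mul hc').aestronglyMeasurable
        · rw [norm_mul, norm_cexp_I_mul_ofReal, one_mul, Complex.norm_real]
          exact abs_circleBessel_le _
      refine h1.congr_fun (fun ρ _ => ?_) measurableSet_Ioi
      simp only [Complex.real_smul]
      push_cast
      ring
    · change ‖dyadicWave a (fun ρ => (ρ : ℂ) ^ (d - 1) * φ ρ) (2 ^ k) t R‖ₑ ≤ _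
      rw [dyadicMax]
      exact le_iSup (fun r : Set.Ici (0 : ℝ) =>
        ‖dyadicWave a (fun ρ => (ρ : ℂ) ^ (d - 1) * φ ρ) (2 ^ k) t r‖ₑ) ⟨R, hR0⟩
  have hJ := integral_cexp_inner_eq h₀ h₁ h₀₁ (Φ := Φ)
    (fun ξ η h => by simp only [hΦ, h]) hΦint x
  rw [hJ, enorm_mul, integral_eq_integral_sphere_integral_Ioi volume hJint, hfin]
  have hpi : ‖(2 * Real.pi : ℂ)⁻¹‖ₑ ≤ 1 := by
    rw [← ofReal_norm, ENNReal.ofReal_le_one, norm_inv]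
    refine inv_le_one_of_one_le₀ ?_
    rw [norm_mul, Complex.norm_real, Real.norm_of_nonneg Real.pi_pos.le]
    simp only [Complex.norm_ofNat]
    linarith [Real.pi_gt_three]
  calc _ ≤ 1 * ∫⁻ ω, (∑' k : ℤ, dyadicMax a (fun ρ => (ρ : ℂ) ^ (d - 1) * φ ρ) (2 ^ k) t)
        ∂(volume : Measure (Ed d)).toSphere := by
        gcongr
        exact (enorm_integral_le_lintegral_enorm _).trans (lintegral_mono hinner)
    _ = _ := by rw [one_mul, lintegral_const, mul_comm]

theorem summable_two_zpow_rpow_mul_min {γ s : ℝ} (hγ : 0 < γ) (hγs : γ < s) :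
    Summable fun k : ℤ => ((2 : ℝ) ^ k) ^ γ * min 1 (((2 : ℝ) ^ k) ^ (-s)) := by
  have hgeom : ∀ δ : ℝ, 0 < δ → Summable fun n : ℕ => ((2 : ℝ) ^ (-δ)) ^ n := fun δ hδ =>
    summable_geometric_of_lt_one (by positivity)
      (Real.rpow_lt_one_of_one_lt_of_neg one_lt_two (by linarith))
  have hpow : ∀ (δ : ℝ) (n : ℕ), ((2 : ℝ) ^ δ) ^ n = ((2 : ℝ) ^ n) ^ δ := fun δ n => by
    rw [← Real.rpow_natCast, ← Real.rpow_mul zero_le_two, mul_comm, Real.rpow_mul zero_le_two,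
      Real.rpow_natCast]
  refine Summable.of_nat_of_neg ?_ ?_
  · refine Summable.of_nonneg_of_le (fun n => by positivity) (fun n => ?_)
      (hgeom _ (sub_pos.2 hγs))
    rw [hpow, zpow_natCast, show -(s - γ) = γ + -s by ring, Real.rpow_add (by positivity)]
    gcongr
    exact min_le_right _ _
  · refine Summable.of_nonneg_of_le (fun n => by positivity) (fun n => ?_) (hgeom _ hγ)
    have hpos : (0 : ℝ) < 2 ^ n := by positivity
    rw [hpow, zpow_neg, zpow_natCast, Real.rpow_neg hpos.le γ, Real.inv_rpow hpos.le]
    refine mul_le_of_le_one_right ?_ (min_le_left _ _)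
    positivity

theorem intervalIntegral_norm_sq_pow_mul_le {n : ℕ} {φ : ℝ → ℂ} (hφ : Continuous φ)
    {w : ℝ → ℝ} {c N : ℝ} (hN : 0 < N) (hc : 0 ≤ c) (hw : ∀ ρ, 0 < ρ → 0 ≤ w ρ)
    (hcw : ∀ ρ, N ≤ ρ → 1 ≤ c * w ρ)
    (hintg : IntegrableOn (fun ρ : ℝ => ρ ^ n * (w ρ * ‖φ ρ‖ ^ 2)) (Set.Ioi 0)) :
    ∫ ρ in N..2 * N, ‖(ρ : ℂ) ^ n * φ ρ‖ ^ 2 ≤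
      (2 * N) ^ n * c * ∫ ρ in Set.Ioi (0 : ℝ), ρ ^ n * (w ρ * ‖φ ρ‖ ^ 2) := by
  have hsub : Set.Ioc N (2 * N) ⊆ Set.Ioi 0 := fun ρ hρ => hN.trans hρ.1
  rw [intervalIntegral.integral_of_le (by linarith)]
  calc ∫ ρ in Set.Ioc N (2 * N), ‖(ρ : ℂ) ^ n * φ ρ‖ ^ 2
      ≤ ∫ ρ in Set.Ioc N (2 * N), (2 * N) ^ n * c * (ρ ^ n * (w ρ * ‖φ ρ‖ ^ 2)) := by
        refine setIntegral_mono_on ?_ ((hintg.mono_set hsub).const_mul _) measurableSet_Ioc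
          fun ρ hρ => ?_
        · exact (Continuous.integrableOn_Icc (by fun_prop)).mono_set Set.Ioc_subset_Icc_self
        · have hρ0 : 0 < ρ := hsub hρ
          rw [norm_mul, norm_pow, Complex.norm_real, Real.norm_of_nonneg hρ0.le]
          have h1 : ρ ^ n ≤ (2 * N) ^ n := pow_le_pow_left₀ hρ0.le hρ.2 n
          have h2 := hcw ρ hρ.1.le
          have h3 : 0 ≤ ρ ^ n * ‖φ ρ‖ ^ 2 := by positivity
          calc (ρ ^ n * ‖φ ρ‖) ^ 2 = ρ ^ n * 1 * (ρ ^ n * ‖φ ρ‖ ^ 2) := by ring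
            _ ≤ (2 * N) ^ n * (c * w ρ) * (ρ ^ n * ‖φ ρ‖ ^ 2) := by gcongr
            _ = _ := by ring
    _ = (2 * N) ^ n * c * ∫ ρ in Set.Ioc N (2 * N), ρ ^ n * (w ρ * ‖φ ρ‖ ^ 2) :=
        integral_const_mul _ _
    _ ≤ _ := by
        refine mul_le_mul_of_nonneg_left (setIntegral_mono_set hintg ?_ hsub.eventuallyLE)
          (by positivity)
        refine (ae_restrict_iff' measurableSet_Ioi).2 (ae_of_all _ fun ρ hρ => ?_)
        have := hw ρ hρ
        have : (0 : ℝ) < ρ := hρ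
        simp only [Pi.zero_apply]
        positivity

theorem sqrt_intervalIntegral_norm_sq_le {n : ℕ} {φ : ℝ → ℂ} (hφ : Continuous φ) {s N : ℝ}
    (hs : 0 < s) (hN : 0 < N)
    (h₀ : IntegrableOn (fun ρ : ℝ => ρ ^ n * ‖φ ρ‖ ^ 2) (Set.Ioi 0))
    (h₁ : IntegrableOn (fun ρ : ℝ => ρ ^ n * (ρ ^ (2 * s) * ‖φ ρ‖ ^ 2)) (Set.Ioi 0)) :
    √(∫ ρ in N..2 * N, ‖(ρ : ℂ) ^ n * φ ρ‖ ^ 2) ≤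
      2 ^ ((n : ℝ) / 2) * N ^ ((n : ℝ) / 2) * min 1 (N ^ (-s)) *
        √((∫ ρ in Set.Ioi (0 : ℝ), ρ ^ n * ‖φ ρ‖ ^ 2) +
          ∫ ρ in Set.Ioi (0 : ℝ), ρ ^ n * (ρ ^ (2 * s) * ‖φ ρ‖ ^ 2)) := by
  set E₀ := ∫ ρ in Set.Ioi (0 : ℝ), ρ ^ n * ‖φ ρ‖ ^ 2 with hE₀
  set E₁ := ∫ ρ in Set.Ioi (0 : ℝ), ρ ^ n * (ρ ^ (2 * s) * ‖φ ρ‖ ^ 2) with hE₁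
  have hE₀' : 0 ≤ E₀ := setIntegral_nonneg measurableSet_Ioi fun ρ hρ => by
    have : (0 : ℝ) < ρ := hρ
    positivity
  have hE₁' : 0 ≤ E₁ := setIntegral_nonneg measurableSet_Ioi fun ρ hρ => by
    have : (0 : ℝ) < ρ := hρ
    positivity
  have b₀ := intervalIntegral_norm_sq_pow_mul_le (n := n) hφ (w := fun _ => 1) (c := 1) hN
    zero_le_one (fun _ _ => zero_le_one) (fun _ _ => by norm_num) (by simpa using h₀)
  have b₁ := intervalIntegral_norm_sq_pow_mul_le (n := n) hφ (w := fun ρ => ρ ^ (2 * s))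
    (c := N ^ (-(2 * s))) hN (by positivity) (fun ρ hρ => by positivity) (fun ρ hρ => by
      rw [Real.rpow_neg hN.le, inv_mul_eq_div, one_le_div (by positivity)]
      exact Real.rpow_le_rpow hN.le hρ (by positivity)) h₁
  simp only [one_mul, mul_one] at b₀
  rw [← hE₀] at b₀
  rw [← hE₁] at b₁
  have hpow : (2 * N) ^ n = (2 ^ ((n : ℝ) / 2) * N ^ ((n : ℝ) / 2)) ^ 2 := by
    rw [← Real.mul_rpow zero_le_two hN.le, ← Real.rpow_mul_natCast (by positivity)]
    push_cast
    rw [div_mul_cancel₀ _ two_ne_zero, Real.rpow_natCast]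
  have hNs : N ^ (-(2 * s)) = (N ^ (-s)) ^ 2 := by
    rw [← Real.rpow_mul_natCast hN.le]
    congr 1
    push_cast
    ring
  set P := 2 ^ ((n : ℝ) / 2) * N ^ ((n : ℝ) / 2) with hP
  have hP0 : 0 ≤ P := by positivity
  refine Real.sqrt_le_iff.2 ⟨by positivity, ?_⟩
  rw [mul_pow, mul_pow, Real.sq_sqrt (by positivity), ← hpow]
  rcases min_cases (1 : ℝ) (N ^ (-s)) with ⟨h, _⟩ | ⟨h, _⟩ <;> rw [h]
  · refine b₀.trans ?_
    rw [one_pow, mul_one]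
    gcongr
    linarith
  · refine b₁.trans ?_
    rw [hNs]
    gcongr
    linarith

theorem lintegral_tsum_dyadicMax_le {d : ℕ} (hd : 2 ≤ d) {s q : ℝ} (hs : 1 / 2 < s)
    (hs1 : s < 1) (hq : 2 ≤ q) (hqd : (d : ℝ) / 2 - 2 * s / q < s) :
    ∃ C : ℝ, 0 < C ∧ ∀ φ : ℝ → ℂ, Continuous φ →
      IntegrableOn (fun ρ : ℝ => ρ ^ (d - 1) * ‖φ ρ‖ ^ 2) (Set.Ioi 0) →
      IntegrableOn (fun ρ : ℝ => ρ ^ (d - 1) * (ρ ^ (2 * s) * ‖φ ρ‖ ^ 2)) (Set.Ioi 0) →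
      (∫⁻ t, (∑' k : ℤ,
          dyadicMax (2 * s) (fun ρ => (ρ : ℂ) ^ (d - 1) * φ ρ) (2 ^ k) t) ^ q) ^ (1 / q) ≤
        ENNReal.ofReal (C * √((∫ ρ in Set.Ioi (0 : ℝ), ρ ^ (d - 1) * ‖φ ρ‖ ^ 2) +
          ∫ ρ in Set.Ioi (0 : ℝ), ρ ^ (d - 1) * (ρ ^ (2 * s) * ‖φ ρ‖ ^ 2))) := by
  obtain ⟨C, hC, h⟩ := lintegral_dyadicMax_rpow_le (a := 2 * s) (by linarith) (by linarith) hq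
  set γ := (d : ℝ) / 2 - 2 * s / q with hγ
  have hd2 : (2 : ℝ) ≤ d := by exact_mod_cast hd
  have hγ0 : 0 < γ := by
    have : 2 * s / q ≤ s := by
      rw [div_le_iff₀ (by linarith)]
      nlinarith
    linarith
  have hsum := summable_two_zpow_rpow_mul_min hγ0 hqd
  set u : ℤ → ℝ := fun k => ((2 : ℝ) ^ k) ^ γ * min 1 (((2 : ℝ) ^ k) ^ (-s)) with hu
  have hu0 : ∀ k, 0 < u k := fun k => by positivity
  have hcast : ((d - 1 : ℕ) : ℝ) = d - 1 := by
    rw [Nat.cast_sub (by omega), Nat.cast_one]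
  refine ⟨C * 2 ^ (((d - 1 : ℕ) : ℝ) / 2) * ∑' k, u k, ?_, fun φ hφ h₀ h₁ => ?_⟩
  · have := hsum.tsum_pos (fun k => (hu0 k).le) 0 (hu0 0)
    positivity
  have hG : Continuous fun ρ : ℝ => (ρ : ℂ) ^ (d - 1) * φ ρ := by fun_prop
  set X := √((∫ ρ in Set.Ioi (0 : ℝ), ρ ^ (d - 1) * ‖φ ρ‖ ^ 2) +
    ∫ ρ in Set.Ioi (0 : ℝ), ρ ^ (d - 1) * (ρ ^ (2 * s) * ‖φ ρ‖ ^ 2)) with hX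
  have hX0 : 0 ≤ X := Real.sqrt_nonneg _
  refine (lintegral_tsum_rpow_le (fun k => measurable_dyadicMax (by linarith) (by positivity) hG)
    (by linarith)).trans ?_
  calc _ ≤ ∑' k : ℤ, ENNReal.ofReal (C * 2 ^ (((d - 1 : ℕ) : ℝ) / 2) * X * u k) := by
        refine ENNReal.tsum_le_tsum fun k => (h _ (by positivity) _ hG).trans
          (ENNReal.ofReal_le_ofReal ?_)
        have hN : (0 : ℝ) < 2 ^ k := by positivity
        set N : ℝ := 2 ^ k
        calc C * N ^ (1 / 2 - 2 * s / q) * √(∫ ρ in N..2 * N, ‖(ρ : ℂ) ^ (d - 1) * φ ρ‖ ^ 2)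
            ≤ C * N ^ (1 / 2 - 2 * s / q) * (2 ^ (((d - 1 : ℕ) : ℝ) / 2) *
              N ^ (((d - 1 : ℕ) : ℝ) / 2) * min 1 (N ^ (-s)) * X) := by
              gcongr
              exact sqrt_intervalIntegral_norm_sq_le hφ (by linarith) hN h₀ h₁
          _ = C * 2 ^ (((d - 1 : ℕ) : ℝ) / 2) * X *
              ((N ^ (1 / 2 - 2 * s / q) * N ^ (((d - 1 : ℕ) : ℝ) / 2)) *
                min 1 (N ^ (-s))) := by ring
          _ = _ := by
              have hexp : 1 / 2 - 2 * s / q + ((d : ℝ) - 1) / 2 = γ := by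
                rw [hγ]
                ring
              rw [← Real.rpow_add hN, hcast, hexp]
    _ = _ := by
        rw [← ENNReal.ofReal_tsum_of_nonneg (fun k => by have := hu0 k; positivity)
          (hsum.mul_left _), tsum_mul_left]
        congr 1
        ring

open scoped FourierTransform in
theorem FT_eq_fourier {d : ℕ} (f : Ed d → ℂ) (ξ : Ed d) :
    FT f ξ = 𝓕 f ((2 * Real.pi)⁻¹ • ξ) := by
  rw [Real.fourier_eq', FT]
  refine integral_congr_ae (ae_of_all _ fun x => ?_)
  simp only [smul_eq_mul, real_inner_smul_right]
  congr 2
  have : -2 * Real.pi * ((2 * Real.pi)⁻¹ * (⟪x, ξ⟫ : ℝ)) = -(⟪x, ξ⟫ : ℝ) := by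
    field_simp
  rw [this]
  push_cast
  ring

open scoped FourierTransform in
theorem exists_schwartzMap_eq_FT {d : ℕ} (f : SchwartzMap (Ed d) ℂ) :
    ∃ g : SchwartzMap (Ed d) ℂ, ∀ ξ, g ξ = FT f ξ := by
  have hpi : (2 * Real.pi)⁻¹ ≠ 0 := inv_ne_zero Real.two_pi_pos.ne'
  refine ⟨SchwartzMap.compCLMOfContinuousLinearEquiv ℂ
    (ContinuousLinearEquiv.smulLeft (R₁ := ℝ) (M₁ := Ed d) (Units.mk0 _ hpi)) (𝓕 f), fun ξ => ?_⟩
  rw [FT_eq_fourier, ← SchwartzMap.fourier_coe]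
  rfl

open scoped FourierTransform in
theorem integral_norm_sq_FT {d : ℕ} (f : SchwartzMap (Ed d) ℂ) :
    ∫ ξ, ‖FT f ξ‖ ^ 2 = (2 * Real.pi) ^ d * ∫ x, ‖f x‖ ^ 2 := by
  simp_rw [FT_eq_fourier, ← SchwartzMap.fourier_coe]
  rw [Measure.integral_comp_inv_smul volume (fun ξ => ‖(𝓕 f : SchwartzMap (Ed d) ℂ) ξ‖ ^ 2),
    SchwartzMap.integral_norm_sq_fourier, finrank_euclideanSpace_fin, smul_eq_mul,
    abs_of_pos (pow_pos Real.two_pi_pos d)]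

theorem FT_eq_of_norm_eq {d : ℕ} {f : Ed d → ℂ} (hf : IsRadial f) {ξ η : Ed d}
    (h : ‖ξ‖ = ‖η‖) : FT f ξ = FT f η := by
  have := integral_inner_eq_of_norm_eq (fun v => Complex.exp (-I * (v : ℂ))) hf h
  simpa only [FT, real_inner_comm] using this

theorem toReal_eLpNorm_two_sq {α F : Type*} [MeasurableSpace α] [NormedAddCommGroup F]
    {μ : Measure α} {f : α → F} (hf : MemLp f 2 μ) :
    (eLpNorm f 2 μ).toReal ^ 2 = ∫ x, ‖f x‖ ^ 2 ∂μ := by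
  have h0 : 0 ≤ ∫ x, ‖f x‖ ^ 2 ∂μ := integral_nonneg fun x => by positivity
  rw [hf.eLpNorm_eq_integral_rpow_norm two_ne_zero ENNReal.ofNat_ne_top]
  simp only [ENNReal.toReal_ofNat, Real.rpow_two]
  rw [ENNReal.toReal_ofReal (by positivity), ← Real.rpow_mul_natCast h0]
  norm_num

theorem SchwartzMap.integrable_rpow_mul_norm_sq {d : ℕ} (g : SchwartzMap (Ed d) ℂ) {s : ℝ}
    (hs : 0 ≤ s) (hs1 : s ≤ 1) :
    Integrable fun ξ : Ed d => ‖ξ‖ ^ (2 * s) * ‖g ξ‖ ^ 2 := by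
  set M := SchwartzMap.seminorm ℝ 0 0 g
  have hM : ∀ ξ, ‖g ξ‖ ≤ M := SchwartzMap.norm_le_seminorm ℝ g
  have hdom : Integrable fun ξ : Ed d => M * (‖ξ‖ ^ 0 * ‖g ξ‖ + ‖ξ‖ ^ 2 * ‖g ξ‖) :=
    ((g.integrable_pow_mul volume 0).add (g.integrable_pow_mul volume 2)).const_mul M
  refine hdom.mono' (Continuous.aestronglyMeasurable ?_) (ae_of_all _ fun ξ => ?_)
  · have := g.continuous
    exact (continuous_norm.rpow_const fun _ => Or.inr (by linarith)).mul (by fun_prop)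
  · have h1 : ‖ξ‖ ^ (2 * s) ≤ 1 + ‖ξ‖ ^ 2 := by
      rcases le_total ‖ξ‖ 1 with h | h
      · have := Real.rpow_le_one (norm_nonneg ξ) h (by linarith : 0 ≤ 2 * s)
        nlinarith [sq_nonneg ‖ξ‖]
      · have := Real.rpow_le_rpow_of_exponent_le h (by linarith : 2 * s ≤ 2)
        rw [Real.rpow_two] at this
        linarith
    rw [Real.norm_of_nonneg (by positivity)]
    calc ‖ξ‖ ^ (2 * s) * ‖g ξ‖ ^ 2 ≤ (1 + ‖ξ‖ ^ 2) * (M * ‖g ξ‖) := by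
          rw [sq ‖g ξ‖]
          gcongr
          exact hM ξ
      _ = _ := by ring

theorem HNorm_sq {d : ℕ} (f : SchwartzMap (Ed d) ℂ) {s : ℝ} (hs : 0 ≤ s) (hs1 : s ≤ 1) :
    (2 * Real.pi) ^ d * HNorm s f ^ 2 =
      (∫ ξ, ‖FT f ξ‖ ^ 2) + ∫ ξ, ‖ξ‖ ^ (2 * s) * ‖FT f ξ‖ ^ 2 := by
  obtain ⟨g, hg⟩ := exists_schwartzMap_eq_FT f
  have hsq : ∀ ξ : Ed d, ‖((‖ξ‖ ^ s : ℝ) : ℂ) * g ξ‖ ^ 2 = ‖ξ‖ ^ (2 * s) * ‖g ξ‖ ^ 2 := fun ξ => by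
    rw [norm_mul, Complex.norm_real, Real.norm_of_nonneg (by positivity), mul_pow,
      ← Real.rpow_mul_natCast (norm_nonneg ξ)]
    congr 2
    push_cast
    ring
  have hmem : MemLp (fun ξ : Ed d => ((‖ξ‖ ^ s : ℝ) : ℂ) * g ξ) 2 volume := by
    rw [memLp_two_iff_integrable_sq_norm]
    · simp_rw [hsq]
      exact g.integrable_rpow_mul_norm_sq hs hs1
    · have := g.continuous
      exact Continuous.aestronglyMeasurable ((Complex.continuous_ofReal.comp
        (continuous_norm.rpow_const fun _ => Or.inr hs)).mul (by fun_prop))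
  have h1 := toReal_eLpNorm_two_sq hmem
  simp_rw [hsq] at h1
  have h2 := toReal_eLpNorm_two_sq (f.memLp 2 (μ := volume))
  have hpi : ((2 * Real.pi) ^ (-(d : ℝ) / 2)) ^ 2 = ((2 * Real.pi) ^ d)⁻¹ := by
    rw [← Real.rpow_mul_natCast Real.two_pi_pos.le]
    push_cast
    rw [div_mul_cancel₀ _ two_ne_zero, Real.rpow_neg Real.two_pi_pos.le, Real.rpow_natCast]
  rw [HNorm, Real.sq_sqrt (by positivity), HdotNorm,
    mul_pow ((2 * Real.pi) ^ (-(d : ℝ) / 2)), hpi, h2, integral_norm_sq_FT]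
  simp_rw [← hg]
  rw [h1, mul_add, mul_inv_cancel_left₀ (pow_pos Real.two_pi_pos d).ne']

theorem mixedNorm_top_le {d : ℕ} {q : ℝ} (hq : 1 ≤ q) {F : ℝ → Ed d → ℂ} {K : ℝ≥0∞}
    (hK : K ≠ ⊤) {S : ℝ → ℝ≥0∞} (h : ∀ t x, ‖F t x‖ₑ ≤ K * S t) :
    mixedNorm (ENNReal.ofReal q) ⊤ F ≤ K * (∫⁻ t, S t ^ q) ^ (1 / q) := by
  have hq0 : 0 < q := by linarith
  rw [mixedNorm, eLpNorm_eq_lintegral_rpow_enorm_toReal (by simpa using hq0)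
    ENNReal.ofReal_ne_top, ENNReal.toReal_ofReal hq0.le]
  have hpt : ∀ t, ‖(eLpNorm (F t) ⊤ volume).toReal‖ₑ ≤ K * S t := fun t => by
    rw [Real.enorm_of_nonneg ENNReal.toReal_nonneg]
    refine ENNReal.ofReal_toReal_le.trans ?_
    rw [eLpNorm_exponent_top]
    exact eLpNormEssSup_le_of_ae_enorm_bound (ae_of_all _ (h t))
  calc _ ≤ (∫⁻ t, (K * S t) ^ q) ^ (1 / q) := by
        gcongr with t
        exact hpt t
    _ = (K ^ q * ∫⁻ t, S t ^ q) ^ (1 / q) := by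
        simp_rw [ENNReal.mul_rpow_of_nonneg _ _ hq0.le]
        rw [lintegral_const_mul' _ _ (ENNReal.rpow_ne_top_of_nonneg hq0.le hK)]
    _ = _ := by
        rw [ENNReal.mul_rpow_of_nonneg _ _ (by positivity), ← ENNReal.rpow_mul,
          mul_one_div_cancel hq0.ne', ENNReal.rpow_one]

theorem stmt9 (d : ℕ) (hd : 2 ≤ d) (s : ℝ) (hs : (d : ℝ) / (2 * d - 1) < s) (hs1 : s < 1)
    (q : ℝ) (hq2 : 2 ≤ q) (hq : q < 4 * s / ((d : ℝ) - 2 * s)) :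
    ∃ C : ℝ, 0 < C ∧ ∀ f : SchwartzMap (Ed d) ℂ, IsRadial (⇑f) →
      mixedNorm (ENNReal.ofReal q) ⊤ (fun t => fprop s t (⇑f))
        ≤ ENNReal.ofReal (C * HNorm s (⇑f)) := by
  have hd2 : (2 : ℝ) ≤ d := by exact_mod_cast hd
  have hd0 : 0 < d := by omega
  have : Nonempty (Fin d) := ⟨⟨0, hd0⟩⟩
  have hs2 : 1 / 2 < s := by
    refine lt_of_le_of_lt ?_ hs
    rw [div_le_div_iff₀ two_pos (by linarith)]
    linarith
  have hqd : (d : ℝ) / 2 - 2 * s / q < s := by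
    rw [lt_div_iff₀ (by linarith)] at hq
    have : (d : ℝ) / 2 - s < 2 * s / q := by
      rw [lt_div_iff₀ (by linarith)]
      linarith
    linarith
  obtain ⟨C, hC, h⟩ := lintegral_tsum_dyadicMax_le hd hs2 hs1 hq2 hqd
  set κ : ℝ := d * volume.real (Metric.ball (0 : Ed d) 1) with hκ
  have hκ0 : 0 < κ := by
    have : 0 < volume.real (Metric.ball (0 : Ed d) 1) :=
      ENNReal.toReal_pos (Metric.measure_ball_pos _ _ one_pos).ne' measure_ball_lt_top.ne
    positivity
  set P : ℝ := (2 * Real.pi) ^ (-(d : ℝ)) with hP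
  have hP0 : 0 < P := Real.rpow_pos_of_pos Real.two_pi_pos _
  have hT0 : (0 : ℝ) < √(κ⁻¹ * (2 * Real.pi) ^ d) := Real.sqrt_pos.2 (by positivity)
  refine ⟨P * κ * (C * √(κ⁻¹ * (2 * Real.pi) ^ d)), by positivity, fun f hf => ?_⟩
  obtain ⟨g, hg⟩ := exists_schwartzMap_eq_FT f
  set e : Ed d := EuclideanSpace.single ⟨0, hd0⟩ 1 with he
  have he1 : ‖e‖ = 1 := by simp [he]
  set φ : ℝ → ℂ := fun ρ => g (ρ • e) with hφ
  have hφc : Continuous φ := g.continuous.comp (by fun_prop)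
  have hgφ : ∀ ξ, φ ‖ξ‖ = g ξ := fun ξ => by
    simp only [hφ, hg]
    exact FT_eq_of_norm_eq hf (by rw [norm_smul, he1, norm_norm, mul_one])
  have hintg : Integrable fun ξ : Ed d => φ ‖ξ‖ := by
    simp_rw [hgφ]
    exact g.integrable
  have hrad : ∀ w : ℝ → ℝ, Integrable (fun ξ : Ed d => w ‖ξ‖) →
      IntegrableOn (fun ρ => ρ ^ (d - 1) * w ρ) (Set.Ioi 0) ∧
        ∫ ρ in Set.Ioi (0 : ℝ), ρ ^ (d - 1) * w ρ = κ⁻¹ * ∫ ξ : Ed d, w ‖ξ‖ := fun w hw => by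
    have h1 := (integrable_fun_norm_addHaar (volume : Measure (Ed d)) (f := w)).1 hw
    have h2 := integral_fun_norm_addHaar (volume : Measure (Ed d)) w
    rw [finrank_euclideanSpace_fin] at h1 h2
    simp only [smul_eq_mul, nsmul_eq_mul] at h1 h2
    refine ⟨h1, ?_⟩
    rw [h2, ← mul_assoc (d : ℝ), inv_mul_cancel_left₀ hκ0.ne']
  have hsq₀ : Integrable fun ξ : Ed d => ‖φ ‖ξ‖‖ ^ 2 := by
    simp_rw [hgφ]
    simpa using g.integrable_rpow_mul_norm_sq le_rfl zero_le_one
  have hsq₁ : Integrable fun ξ : Ed d => ‖ξ‖ ^ (2 * s) * ‖φ ‖ξ‖‖ ^ 2 := by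
    simp_rw [hgφ]
    exact g.integrable_rpow_mul_norm_sq (by linarith) hs1.le
  obtain ⟨i₀, v₀⟩ := hrad (fun ρ => ‖φ ρ‖ ^ 2) hsq₀
  obtain ⟨i₁, v₁⟩ := hrad (fun ρ => ρ ^ (2 * s) * ‖φ ρ‖ ^ 2) hsq₁
  have hmain := h φ hφc i₀ i₁
  have henergy : (κ⁻¹ * ∫ ξ : Ed d, ‖φ ‖ξ‖‖ ^ 2) +
      κ⁻¹ * ∫ ξ : Ed d, ‖ξ‖ ^ (2 * s) * ‖φ ‖ξ‖‖ ^ 2 =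
      (κ⁻¹ * (2 * Real.pi) ^ d) * HNorm s f ^ 2 := by
    simp_rw [hgφ, hg]
    rw [mul_assoc, HNorm_sq f (by linarith) hs1.le, mul_add]
  have hH0 : 0 ≤ HNorm s f := Real.sqrt_nonneg _
  rw [v₀, v₁, henergy, Real.sqrt_mul (by positivity), Real.sqrt_sq hH0] at hmain
  have hpt : ∀ t x, ‖fprop s t f x‖ₑ ≤ ENNReal.ofReal (P * κ) *
      ∑' k : ℤ, dyadicMax (2 * s) (fun ρ => (ρ : ℂ) ^ (d - 1) * φ ρ) (2 ^ k) t := fun t x => by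
    have h1 := enorm_radialWave_le hd (2 * s) hintg t x
    rw [Measure.toSphere_apply_univ, finrank_euclideanSpace_fin] at h1
    have h2 : ENNReal.ofReal (P * κ) =
        ENNReal.ofReal P * (d * volume (Metric.ball (0 : Ed d) 1)) := by
      rw [ENNReal.ofReal_mul hP0.le, hκ, ENNReal.ofReal_mul (by positivity),
        ENNReal.ofReal_natCast, Measure.real, ENNReal.ofReal_toReal measure_ball_lt_top.ne]
    rw [fprop, FTinv, enorm_mul, h2, mul_assoc]
    gcongr
    · rw [← ofReal_norm, Complex.norm_real, Real.norm_of_nonneg hP0.le]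
    · refine le_of_eq_of_le (congrArg _ ?_) h1
      refine integral_congr_ae (ae_of_all _ fun ξ => ?_)
      simp only [hgφ, hg]
      congr 3
      push_cast
      ring
  refine (mixedNorm_top_le (by linarith) ENNReal.ofReal_ne_top hpt).trans ?_
  refine (mul_le_mul_right hmain _).trans_eq ?_
  rw [← ENNReal.ofReal_mul (by positivity)]
  congr 1
  ring

end
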